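/- arXiv:1703.04167 — 5 statements merged into one kernel-verified Lean document; each statement's English description precedes it below -/
import Mathlib

section
/- For every nonnegative integer k, the following identity holds in the polynomial ring ℤ[u,v,w,x,y,z]: the sum over all pairs of nonnegative integers (i,j) with i + j ≤ k of C(k, i+j)·C(k+i, k)·C(k+j, k) times [ (−wx)^i (vx)^j u^{k+1} Δ1^{2k+1} Δ2^{k−i} Δ3^{k−j} + (−uy)^i (wy)^j v^{k+1} Δ2^{2k+1} Δ3^{k−i} Δ1^{k−j} + (−vz)^i (uz)^j w^{k+1} Δ3^{2k+1} Δ1^{k−i} Δ2^{k−j} ] equals 0. (This is the identity Σ_{i,j} C(k,i+j)C(k+i,k)C(k+j,k)(−wx)^i(vx)^j u^{k+1}/(Δ2^{k+1+i}Δ3^{k+1+j}) + Σ_{i,j} C(k,i+j)C(k+i,k)C(k+j,k)(−uy)^i(wy)^j v^{k+1}/(Δ3^{k+1+i}Δ1^{k+1+j}) + Σ_{i,j} C(k,i+j)C(k+i,k)C(k+j,k)(−vz)^i(uz)^j w^{k+1}/(Δ1^{k+1+i}Δ2^{k+1+j}) = 0, rewritten as a polynomial identity after multiplying through by (Δ1Δ2Δ3)^{2k+1}.)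 -/
open MvPolynomial Finset

/-- The six entries of the generic `2 × 3` matrix. -/
noncomputable def U : MvPolynomial (Fin 6) ℤ := X 0
noncomputable def V : MvPolynomial (Fin 6) ℤ := X 1
noncomputable def W : MvPolynomial (Fin 6) ℤ := X 2
noncomputable def Xx : MvPolynomial (Fin 6) ℤ := X 3
noncomputable def Yy : MvPolynomial (Fin 6) ℤ := X 4
noncomputable def Zz : MvPolynomial (Fin 6) ℤ := X 5

/-- The size-two minors of the generic `2 × 3` matrix. -/
noncomputable def Δ1 : MvPolynomial (Fin 6) ℤ := V * Zz - W * Yy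
noncomputable def Δ2 : MvPolynomial (Fin 6) ℤ := W * Xx - U * Zz
noncomputable def Δ3 : MvPolynomial (Fin 6) ℤ := U * Yy - V * Xx

lemma pf_two {K : Type*} [Field K] (P Q f : Polynomial K) (h : IsCoprime P Q) (hP : P ≠ 0) (hQ : Q ≠ 0)
    (hf : f.degree < P.degree + Q.degree) :
    ∃ A B : Polynomial K, A.degree < P.degree ∧ B.degree < Q.degree ∧ f = A * Q + B * P := by
  obtain ⟨a, b, hab⟩ := h
  have e := EuclideanDomain.div_add_mod (f * b) P
  have hA : ((f * b) % P).degree < P.degree := Polynomial.degree_mod_lt _ hP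
  have key : f = ((f * b) % P) * Q + (f * a + ((f * b) / P) * Q) * P := by
    linear_combination (-f) * hab - Q * e
  refine ⟨(f * b) % P, f * a + ((f * b) / P) * Q, hA, ?_, key⟩
  set A := (f * b) % P
  set B := f * a + ((f * b) / P) * Q
  have h1 : (B * P).degree < P.degree + Q.degree := by
    have : B * P = f - A * Q := by linear_combination -key
    rw [this]
    refine lt_of_le_of_lt (Polynomial.degree_sub_le _ _) (max_lt hf ?_)
    rw [Polynomial.degree_mul, Polynomial.degree_eq_natDegree hQ]
    exact WithBot.add_lt_add_right (by simp) hA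
  rw [Polynomial.degree_mul, add_comm, Polynomial.degree_eq_natDegree hP] at h1
  exact lt_of_add_lt_add_left h1

lemma coeff_scale {K : Type*} [Field K] (k : ℕ) (a : K) (A : Polynomial K) (hA : A.degree < (k+1 : ℕ)) :
    (A.comp (Polynomial.C a * (1 + Polynomial.X))).coeff k = A.coeff k * a ^ k := by
  by_cases h0 : A = 0
  · simp [h0]
  have hn : A.natDegree < k + 1 := by
    rwa [Polynomial.natDegree_lt_iff_degree_lt h0]
  rw [Polynomial.comp, Polynomial.eval₂_eq_sum_range' _ hn, Polynomial.finsetSum_coeff,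
    Finset.sum_range_succ, Finset.sum_eq_zero]
  · simp only [mul_pow, ← Polynomial.C_pow, Polynomial.coeff_C_mul, Polynomial.coeff_one_add_X_pow]
    simp
  · intro i hi
    simp only [mul_pow, ← Polynomial.C_pow, Polynomial.coeff_C_mul, Polynomial.coeff_one_add_X_pow]
    rw [Nat.choose_eq_zero_of_lt (by simpa using hi)]
    simp

noncomputable def Hs {K : Type*} [Field K] (k : ℕ) (c : K) : PowerSeries K :=
  PowerSeries.mk fun n => ((k + n).choose k : K) * c ^ n

lemma Hs_mul {K : Type*} [Field K] (k : ℕ) (c : K) :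
    Hs k c * (1 - PowerSeries.C c * PowerSeries.X) ^ (k + 1) = 1 := by
  have h1 : Hs k c = PowerSeries.rescale c ((PowerSeries.mk 1) ^ (k + 1)) := by
    rw [PowerSeries.mk_one_pow_eq_mk_choose_add]
    ext n
    simp [Hs, PowerSeries.coeff_rescale, mul_comm]
  have h2 : (1 - PowerSeries.C c * PowerSeries.X) = PowerSeries.rescale c (1 - PowerSeries.X) := by
    simp [PowerSeries.rescale_X]
  rw [h1, h2, ← map_pow, ← map_mul, ← mul_pow, PowerSeries.mk_one_mul_one_sub_eq_one]
  simp

lemma coeff_HH {K : Type*} [Field K] (k : ℕ) (c d : K) :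
    PowerSeries.coeff k (Hs k c * Hs k d * (((1 + Polynomial.X) ^ k : Polynomial K) : PowerSeries K)) =
    ∑ i ∈ range (k + 1), ∑ j ∈ range (k + 1 - i),
      ((k.choose (i + j) * (k + i).choose k * (k + j).choose k : ℕ) : K) * (c ^ i * d ^ j) := by
  rw [← Finset.sum_range_diag_flip (k+1) (fun i j => ((k.choose (i + j) * (k + i).choose k * (k + j).choose k : ℕ) : K) * (c ^ i * d ^ j)),
    PowerSeries.coeff_mul, Finset.Nat.sum_antidiagonal_eq_sum_range_succ_mk]
  refine Finset.sum_congr rfl fun m hm => ?_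
  have hm' : m ≤ k := by simpa [Nat.lt_succ_iff] using hm
  rw [Polynomial.coeff_coe, Polynomial.coeff_one_add_X_pow, Nat.choose_symm hm',
    PowerSeries.coeff_mul, Finset.Nat.sum_antidiagonal_eq_sum_range_succ_mk, Finset.sum_mul]
  refine Finset.sum_congr rfl fun i hi => ?_
  have hi' : i ≤ m := by simpa [Nat.lt_succ_iff] using hi
  simp only [Hs, PowerSeries.coeff_mk]
  rw [Nat.add_sub_cancel' hi']
  push_cast
  ring

lemma pole {K : Type*} [Field K] (k : ℕ) (u v w x y z D1 D2 D3 : K) (hu : u ≠ 0) (hx : x ≠ 0)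
    (h2 : D2 ≠ 0) (h3 : D3 ≠ 0) (e2 : D2 = w * x - u * z) (e3 : D3 = u * y - v * x)
    (A B : Polynomial K) (hA : A.degree < (k + 1 : ℕ))
    (hAB : (Polynomial.X : Polynomial K) ^ k =
      A * ((Polynomial.C v * Polynomial.X - Polynomial.C y) ^ (k + 1) *
        (Polynomial.C w * Polynomial.X - Polynomial.C z) ^ (k + 1)) +
      B * (Polynomial.C u * Polynomial.X - Polynomial.C x) ^ (k + 1)) :
    ∑ i ∈ range (k + 1), ∑ j ∈ range (k + 1 - i),
      ((k.choose (i + j) * (k + i).choose k * (k + j).choose k : ℕ) : K) *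
        ((-(w * x)) ^ i * (v * x) ^ j * u ^ (k + 1) *
          (D1 ^ (2 * k + 1) * D2 ^ (k - i) * D3 ^ (k - j))) =
    (D1 * D2 * D3) ^ (2 * k + 1) * (-1) ^ (k + 1) * (A.coeff k / u ^ (k + 1)) := by
  set a := x / u with ha
  have ha0 : a ≠ 0 := div_ne_zero hx hu
  set c := -(w * x) / D2 with hc
  set d := v * x / D3 with hd
  -- substitute
  have hcomp := congrArg (fun p : Polynomial K => ((p.comp (Polynomial.C a * (1 + Polynomial.X)) : Polynomial K) : PowerSeries K)) hAB
  simp only [Polynomial.add_comp, Polynomial.mul_comp, Polynomial.pow_comp, Polynomial.sub_comp,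
    Polynomial.X_comp, Polynomial.C_comp, Polynomial.coe_add, Polynomial.coe_mul, Polynomial.coe_pow] at hcomp
  have l1 : Polynomial.C u * (Polynomial.C a * (1 + Polynomial.X)) - Polynomial.C x = Polynomial.C x * Polynomial.X := by
    have : u * a = x := by rw [ha]; field_simp
    rw [← mul_assoc, ← Polynomial.C_mul, this]; ring
  have l2 : ((Polynomial.C v * (Polynomial.C a * (1 + Polynomial.X)) - Polynomial.C y : Polynomial K) : PowerSeries K) =
      PowerSeries.C (-D3 / u) * (1 - PowerSeries.C d * PowerSeries.X) := by
    have t1 : v * a - y = -D3 / u := by rw [ha, e3]; field_simp; ring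
    have t2 : v * a = D3 / u * d := by rw [ha, hd]; field_simp
    have : Polynomial.C v * (Polynomial.C a * (1 + Polynomial.X)) - Polynomial.C y =
      Polynomial.C (-D3/u) * (1 - Polynomial.C d * Polynomial.X) := by
      have t3 := congrArg Polynomial.C t1
      have t4 := congrArg Polynomial.C t2
      simp only [neg_div, Polynomial.C_mul, Polynomial.C_sub, Polynomial.C_neg] at t3 t4 ⊢
      linear_combination t3 + Polynomial.X * t4
    rw [this]; simp [Polynomial.coe_sub]
  have l3 : ((Polynomial.C w * (Polynomial.C a * (1 + Polynomial.X)) - Polynomial.C z : Polynomial K) : PowerSeries K) =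
      PowerSeries.C (D2 / u) * (1 - PowerSeries.C c * PowerSeries.X) := by
    have t1 : w * a - z = D2 / u := by rw [ha, e2]; field_simp
    have t2 : w * a = -(D2 / u * c) := by rw [ha, hc]; field_simp
    have : Polynomial.C w * (Polynomial.C a * (1 + Polynomial.X)) - Polynomial.C z =
      Polynomial.C (D2/u) * (1 - Polynomial.C c * Polynomial.X) := by
      have t3 := congrArg Polynomial.C t1
      have t4 := congrArg Polynomial.C t2
      simp only [Polynomial.C_mul, Polynomial.C_sub, Polynomial.C_neg] at t3 t4 ⊢
      linear_combination t3 + Polynomial.X * t4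
    rw [this]; simp [Polynomial.coe_sub]
  rw [l1, l2, l3] at hcomp
  have hc1 := Hs_mul k c
  have hd1 := Hs_mul k d
  set As : PowerSeries K := ((A.comp (Polynomial.C a * (1 + Polynomial.X)) : Polynomial K) : PowerSeries K) with hAs
  set Bs : PowerSeries K := ((B.comp (Polynomial.C a * (1 + Polynomial.X)) : Polynomial K) : PowerSeries K)
  have hcoA : PowerSeries.coeff k As = A.coeff k * a ^ k := by
    rw [hAs, Polynomial.coeff_coe, coeff_scale k a A hA]
  have main : PowerSeries.C (a ^ k) * (Hs k c * Hs k d * (((1 + Polynomial.X) ^ k : Polynomial K) : PowerSeries K)) =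
      PowerSeries.C ((-D3 / u) ^ (k+1) * (D2 / u) ^ (k+1)) * As +
      (Hs k c * Hs k d * Bs * PowerSeries.C x ^ (k+1)) * PowerSeries.X ^ (k+1) := by
    simp only [Polynomial.coe_mul, Polynomial.coe_C, Polynomial.coe_X, mul_pow, map_mul, map_pow, Polynomial.coe_pow, Polynomial.coe_add, Polynomial.coe_one] at hcomp ⊢
    generalize (1 - PowerSeries.C c * PowerSeries.X) ^ (k + 1) = p at *
    generalize (1 - PowerSeries.C d * PowerSeries.X) ^ (k + 1) = q at *
    linear_combination (Hs k c * Hs k d) * hcomp + PowerSeries.C (-D3 / u) ^ (k+1) * PowerSeries.C (D2 / u) ^ (k+1) * As * (Hs k d * q * hc1 + hd1)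
  have hk := congrArg (PowerSeries.coeff k) main
  rw [map_add, PowerSeries.coeff_C_mul, PowerSeries.coeff_C_mul, coeff_HH, hcoA,
    PowerSeries.coeff_mul_X_pow', if_neg (by omega), add_zero] at hk
  have hS : ∑ i ∈ range (k + 1), ∑ j ∈ range (k + 1 - i),
      ((k.choose (i + j) * (k + i).choose k * (k + j).choose k : ℕ) : K) * (c ^ i * d ^ j) =
      (-D3 / u) ^ (k+1) * (D2 / u) ^ (k+1) * A.coeff k := by
    apply mul_left_cancel₀ (pow_ne_zero k ha0)
    rw [hk]; ring
  have hT : A.coeff k / u ^ (k+1) * (-1) ^ (k+1) * (D2 * D3) ^ (2 * k + 1) * D1 ^ (2 * k + 1) =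
     ((-D3 / u) ^ (k+1) * (D2 / u) ^ (k+1) * A.coeff k) * (u ^ (k+1) * D2 ^ k * D3 ^ k * D1 ^ (2 * k + 1)) := by
    rw [neg_div, neg_pow (D3 / u)]
    simp only [div_pow]
    field_simp
    ring
  rw [show (D1 * D2 * D3) ^ (2 * k + 1) * (-1) ^ (k + 1) * (A.coeff k / u ^ (k + 1)) = A.coeff k / u ^ (k+1) * (-1) ^ (k+1) * (D2 * D3) ^ (2 * k + 1) * D1 ^ (2 * k + 1) by ring, hT, ← hS, Finset.sum_mul]
  refine Finset.sum_congr rfl fun i hi => ?_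
  rw [Finset.sum_mul]
  refine Finset.sum_congr rfl fun j hj => ?_
  simp only [Finset.mem_range] at hi hj
  obtain ⟨p, hp⟩ := Nat.exists_eq_add_of_le (show i ≤ k by omega)
  obtain ⟨q, hq⟩ := Nat.exists_eq_add_of_le (show j ≤ k by omega)
  have s1 : c ^ i * D2 ^ k = (-(w * x)) ^ i * D2 ^ (k - i) := by
    rw [show k - i = p by omega, hp, pow_add, hc, div_pow]; field_simp
  have s2 : d ^ j * D3 ^ k = (v * x) ^ j * D3 ^ (k - j) := by
    rw [show k - j = q by omega, hq, pow_add, hd, div_pow]; field_simp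
  generalize ((k.choose (i + j) * (k + i).choose k * (k + j).choose k : ℕ) : K) = n
  linear_combination (-(n * u ^ (k+1) * D1 ^ (2*k+1))) * (d ^ j * D3 ^ k * s1 + (-(w * x)) ^ i * D2 ^ (k - i) * s2)

lemma lin_coprime {K : Type*} [Field K] (u v x y : K) (h : u * y - v * x ≠ 0) (n : ℕ) :
    IsCoprime ((Polynomial.C u * Polynomial.X - Polynomial.C x) ^ n)
      ((Polynomial.C v * Polynomial.X - Polynomial.C y) ^ n) := by
  apply IsCoprime.pow
  refine ⟨Polynomial.C (v / (u * y - v * x)), Polynomial.C (-u / (u * y - v * x)), ?_⟩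
  have t1 : v / (u * y - v * x) * u + (-u / (u * y - v * x)) * v = 0 := by field_simp; ring
  have t2 : -(v / (u * y - v * x) * x) - (-u / (u * y - v * x)) * y = 1 := by field_simp; ring
  have t3 := congrArg Polynomial.C t1
  have t4 := congrArg Polynomial.C t2
  simp only [Polynomial.C_mul, Polynomial.C_sub, Polynomial.C_neg, Polynomial.C_add, Polynomial.C_0, Polynomial.C_1] at t3 t4
  linear_combination Polynomial.X * t3 + t4

lemma lin_deg {K : Type*} [Field K] (u x : K) (h : u ≠ 0) (n : ℕ) :
    ((Polynomial.C u * Polynomial.X - Polynomial.C x) ^ n).degree = (n : WithBot ℕ) := by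
  rw [Polynomial.degree_pow, sub_eq_add_neg, ← Polynomial.C_neg, Polynomial.degree_linear h]; simp

lemma top_coeff {K : Type*} [Field K] (k : ℕ) (v w y z : K) (A : Polynomial K) (hA : A.degree < (k + 1 : ℕ)) :
    (A * ((Polynomial.C v * Polynomial.X - Polynomial.C y) ^ (k + 1) *
        (Polynomial.C w * Polynomial.X - Polynomial.C z) ^ (k + 1))).coeff (k + ((k + 1) + (k + 1))) =
      A.coeff k * (v ^ (k + 1) * w ^ (k + 1)) := by
  have hl : ∀ v y : K, (Polynomial.C v * Polynomial.X - Polynomial.C y).natDegree ≤ 1 := fun v y => by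
    compute_degree
  have hp : ∀ v y : K, ((Polynomial.C v * Polynomial.X - Polynomial.C y) ^ (k+1)).natDegree ≤ k + 1 := fun v y => by
    simpa using Polynomial.natDegree_pow_le_of_le (k+1) (hl v y)
  have hc : ∀ v y : K, ((Polynomial.C v * Polynomial.X - Polynomial.C y) ^ (k+1)).coeff (k + 1) = v ^ (k+1) := fun v y => by
    have := Polynomial.coeff_pow_of_natDegree_le (m := k+1) (hl v y)
    rw [mul_one] at this
    rw [this]; simp [Polynomial.coeff_C]
  have hA' : A.natDegree ≤ k := by
    by_cases h0 : A = 0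
    · simp [h0]
    · exact Nat.lt_succ_iff.mp ((Polynomial.natDegree_lt_iff_degree_lt h0).mpr hA)
  rw [Polynomial.coeff_mul_add_eq_of_natDegree_le hA' (Polynomial.natDegree_mul_le_of_le (hp _ _) (hp _ _)),
    Polynomial.coeff_mul_add_eq_of_natDegree_le (hp _ _) (hp _ _), hc, hc]

lemma field_identity {K : Type*} [Field K] (k : ℕ) (u v w x y z D1 D2 D3 : K)
    (hu : u ≠ 0) (hv : v ≠ 0) (hw : w ≠ 0) (hx : x ≠ 0) (hy : y ≠ 0) (hz : z ≠ 0)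
    (h1 : D1 ≠ 0) (h2 : D2 ≠ 0) (h3 : D3 ≠ 0)
    (e1 : D1 = v * z - w * y) (e2 : D2 = w * x - u * z) (e3 : D3 = u * y - v * x) :
    (∑ i ∈ range (k + 1), ∑ j ∈ range (k + 1 - i),
      ((k.choose (i + j) * (k + i).choose k * (k + j).choose k : ℕ) : K) *
        ((-(w * x)) ^ i * (v * x) ^ j * u ^ (k + 1) *
          (D1 ^ (2 * k + 1) * D2 ^ (k - i) * D3 ^ (k - j)))) +
    (∑ i ∈ range (k + 1), ∑ j ∈ range (k + 1 - i),
      ((k.choose (i + j) * (k + i).choose k * (k + j).choose k : ℕ) : K) *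
        ((-(u * y)) ^ i * (w * y) ^ j * v ^ (k + 1) *
          (D2 ^ (2 * k + 1) * D3 ^ (k - i) * D1 ^ (k - j)))) +
    (∑ i ∈ range (k + 1), ∑ j ∈ range (k + 1 - i),
      ((k.choose (i + j) * (k + i).choose k * (k + j).choose k : ℕ) : K) *
        ((-(v * z)) ^ i * (u * z) ^ j * w ^ (k + 1) *
          (D3 ^ (2 * k + 1) * D1 ^ (k - i) * D2 ^ (k - j)))) = 0 := by
  have c12 := lin_coprime u v x y (e3 ▸ h3) (k+1)
  have c13 := (lin_coprime w u z x (e2 ▸ h2) (k+1)).symm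
  have c23 := lin_coprime v w y z (e1 ▸ h1) (k+1)
  have d1 := lin_deg u x hu (k+1)
  have d2 := lin_deg v y hv (k+1)
  have d3 := lin_deg w z hw (k+1)
  have t1 := fun A hA => top_coeff k v w y z A hA
  have t2 := fun A hA => top_coeff k w u z x A hA
  have t3 := fun A hA => top_coeff k u v x y A hA
  have p1 := fun A B hA hAB => pole k u v w x y z D1 D2 D3 hu hx h2 h3 e2 e3 A B hA hAB
  have p2 := fun A B hA hAB => pole k v w u y z x D2 D3 D1 hv hy h3 h1 e3 e1 A B hA hAB
  have p3 := fun A B hA hAB => pole k w u v z x y D3 D1 D2 hw hz h1 h2 e1 e2 A B hA hAB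
  generalize (Polynomial.C u * Polynomial.X - Polynomial.C x) ^ (k+1) = P1 at *
  generalize (Polynomial.C v * Polynomial.X - Polynomial.C y) ^ (k+1) = P2 at *
  generalize (Polynomial.C w * Polynomial.X - Polynomial.C z) ^ (k+1) = P3 at *
  have n1 : P1 ≠ 0 := by rintro rfl; rw [Polynomial.degree_zero] at d1; exact WithBot.bot_ne_coe d1
  have n2 : P2 ≠ 0 := by rintro rfl; rw [Polynomial.degree_zero] at d2; exact WithBot.bot_ne_coe d2
  have n3 : P3 ≠ 0 := by rintro rfl; rw [Polynomial.degree_zero] at d3; exact WithBot.bot_ne_coe d3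
  obtain ⟨A, B, hA, hB, hAB⟩ := pf_two P1 (P2 * P3) (Polynomial.X ^ k) (c12.mul_right c13) n1 (mul_ne_zero n2 n3) (by
    rw [Polynomial.degree_mul, d1, d2, d3, Polynomial.degree_X_pow]; norm_cast; omega)
  obtain ⟨A2, A3, hA2, hA3, hB2⟩ := pf_two P2 P3 B c23 n2 n3 (by rwa [Polynomial.degree_mul] at hB)
  rw [d1] at hA
  rw [d2] at hA2
  rw [d3] at hA3
  rw [p1 A B hA hAB, p2 A2 (A * P3 + A3 * P1) hA2 (by rw [hAB, hB2]; ring),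
    p3 A3 (A * P2 + A2 * P1) hA3 (by rw [hAB, hB2]; ring)]
  have hco := congrArg (fun p => Polynomial.coeff p (k + ((k + 1) + (k + 1)))) hAB
  rw [hB2, show A * (P2 * P3) + (A2 * P3 + A3 * P2) * P1 = A * (P2 * P3) + A2 * (P3 * P1) + A3 * (P1 * P2) by ring,
    Polynomial.coeff_add, Polynomial.coeff_add, t1 A hA, t2 A2 hA2, t3 A3 hA3, Polynomial.coeff_X_pow, if_neg (by omega)] at hco
  have hfin : A.coeff k / u ^ (k+1) + A2.coeff k / v ^ (k+1) + A3.coeff k / w ^ (k+1) = 0 := by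
    field_simp
    linear_combination -hco
  linear_combination (D1 * D2 * D3) ^ (2 * k + 1) * (-1) ^ (k + 1) * hfin

theorem polynomial_identity (k : ℕ) :
    (∑ i ∈ range (k + 1), ∑ j ∈ range (k + 1 - i),
      ((k.choose (i + j) * (k + i).choose k * (k + j).choose k : ℕ) : MvPolynomial (Fin 6) ℤ) *
        ((-(W * Xx)) ^ i * (V * Xx) ^ j * U ^ (k + 1) *
          (Δ1 ^ (2 * k + 1) * Δ2 ^ (k - i) * Δ3 ^ (k - j)))) +
    (∑ i ∈ range (k + 1), ∑ j ∈ range (k + 1 - i),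
      ((k.choose (i + j) * (k + i).choose k * (k + j).choose k : ℕ) : MvPolynomial (Fin 6) ℤ) *
        ((-(U * Yy)) ^ i * (W * Yy) ^ j * V ^ (k + 1) *
          (Δ2 ^ (2 * k + 1) * Δ3 ^ (k - i) * Δ1 ^ (k - j)))) +
    (∑ i ∈ range (k + 1), ∑ j ∈ range (k + 1 - i),
      ((k.choose (i + j) * (k + i).choose k * (k + j).choose k : ℕ) : MvPolynomial (Fin 6) ℤ) *
        ((-(V * Zz)) ^ i * (U * Zz) ^ j * W ^ (k + 1) *
          (Δ3 ^ (2 * k + 1) * Δ1 ^ (k - i) * Δ2 ^ (k - j)))) = 0 := by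
  have nz : ∀ (p : MvPolynomial (Fin 6) ℤ) (f : Fin 6 → ℤ), eval f p ≠ 0 → p ≠ 0 := by
    rintro p f h rfl
    simp at h
  have inj := IsFractionRing.injective (MvPolynomial (Fin 6) ℤ) (FractionRing (MvPolynomial (Fin 6) ℤ))
  have nz' : ∀ (p : MvPolynomial (Fin 6) ℤ) (f : Fin 6 → ℤ), eval f p ≠ 0 →
      algebraMap _ (FractionRing (MvPolynomial (Fin 6) ℤ)) p ≠ 0 := fun p f h =>
    (map_ne_zero_iff _ inj).mpr (nz p f h)
  apply inj
  have key := field_identity k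
    (algebraMap _ (FractionRing (MvPolynomial (Fin 6) ℤ)) U) (algebraMap _ _ V) (algebraMap _ _ W)
    (algebraMap _ _ Xx) (algebraMap _ _ Yy) (algebraMap _ _ Zz)
    (algebraMap _ _ Δ1) (algebraMap _ _ Δ2) (algebraMap _ _ Δ3)
    (nz' _ (fun _ => 1) (by simp [U])) (nz' _ (fun _ => 1) (by simp [V]))
    (nz' _ (fun _ => 1) (by simp [W])) (nz' _ (fun _ => 1) (by simp [Xx]))
    (nz' _ (fun _ => 1) (by simp [Yy])) (nz' _ (fun _ => 1) (by simp [Zz]))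
    (nz' _ ![0, 1, 0, 0, 0, 1] (by simp [Δ1, V, W, Yy, Zz]))
    (nz' _ ![0, 0, 1, 1, 0, 0] (by simp [Δ2, W, Xx, U, Zz]))
    (nz' _ ![1, 0, 0, 0, 1, 0] (by simp [Δ3, U, V, Xx, Yy]))
    (by simp [Δ1]) (by simp [Δ2]) (by simp [Δ3])
  simp only [map_add, map_sum, map_mul, map_pow, map_neg, map_natCast, map_zero]
  exact key
end

section
/- Let p be a prime integer, e ≥ 0 an integer, and set k = p^e − 1. Then for all nonnegative integers i and j with (i,j) ≠ (0,0), the product of binomial coefficients C(k, i+j)·C(k+i, k)·C(k+j, k) is divisible by p (with the convention that C(k, i+j) = 0 when i + j > k). -/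
lemma aux_dvd (p : ℕ) (hp : p.Prime) (e k : ℕ) (hk : k + 1 = p ^ e) (i : ℕ) (h0 : 0 < i)
    (hi : i ≤ k) : p ∣ (k + i).choose k := by
  by_contra h
  obtain ⟨m, rfl⟩ : ∃ m, i = m + 1 := ⟨i - 1, by omega⟩
  have h1 := Nat.choose_succ_right_eq (k + (m + 1)) m
  have h2 : k + (m + 1) - m = p ^ e := by omega
  rw [h2, ← Nat.choose_symm_add] at h1
  have hc : Nat.Coprime (p ^ e) ((k + (m + 1)).choose k) :=
    Nat.Coprime.pow_left e ((Nat.Prime.coprime_iff_not_dvd hp).2 h)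
  have hd : p ^ e ∣ m + 1 := hc.dvd_of_dvd_mul_left (h1 ▸ Dvd.intro_left _ rfl)
  have := Nat.le_of_dvd h0 hd
  omega

/-- For `p` prime, `e ≥ 0` and `k = p ^ e - 1`, the product of binomial coefficients
`C(k, i+j) * C(k+i, k) * C(k+j, k)` is divisible by `p` whenever `(i, j) ≠ (0, 0)`. -/
theorem binomial_product_divisible (p : ℕ) (hp : p.Prime) (e : ℕ) (k : ℕ)
    (hk : k = p ^ e - 1) (i j : ℕ) (hij : (i, j) ≠ (0, 0)) :
    p ∣ k.choose (i + j) * (k + i).choose k * (k + j).choose k := by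
  have hpos : 0 < p ^ e := pow_pos hp.pos e
  have hk' : k + 1 = p ^ e := by omega
  by_cases hgt : k < i + j
  · simp [Nat.choose_eq_zero_of_lt hgt]
  · by_cases h0 : i = 0
    · have hj : j ≠ 0 := fun hj => hij (by rw [h0, hj])
      exact Dvd.dvd.mul_left (aux_dvd p hp e k hk' j (by omega) (by omega)) _
    · exact Dvd.dvd.mul_right
        (Dvd.dvd.mul_left (aux_dvd p hp e k hk' i (by omega) (by omega)) _) _
end

section
/- Let p be a prime, e ≥ 0, q = p^e, and k = q − 1. Let F ∈ ℤ[u,v,w,x,y,z] be the polynomial obtained by applying the k-th iterated partial derivative with respect to z, then the k-th iterated partial derivative with respect to y, then the k-th iterated partial derivative with respect to u, to the polynomial u·Δ2^k·Δ3^k. Then there exists a (necessarily unique) polynomial P ∈ ℤ[u,v,w,x,y,z] such that (k!)^3·P = F, and moreover P ≡ u^q modulo p, i.e., every coefficient of P − u^q is divisible by p. (That is, the divided-power differential operator D = (1/k!)∂^k/∂u^k · (1/k!)∂^k/∂y^k · (1/k!)∂^k/∂z^k satisfies D(u·Δ2^{q−1}·Δ3^{q−1}) ≡ u^q mod p.)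 -/
open MvPolynomial

/-- Iterated derivation of a power of an element with constant derivative. -/
theorem iterate_deriv_pow (D : Derivation ℤ (MvPolynomial (Fin 6) ℤ) (MvPolynomial (Fin 6) ℤ))
    (b c L : MvPolynomial (Fin 6) ℤ) (hL : D L = b) (hb : D b = 0) (hc : D c = 0) (n j : ℕ) :
    (⇑D)^[j] (c * L ^ n) = (n.descFactorial j : MvPolynomial (Fin 6) ℤ) * b ^ j * c * L ^ (n - j) := by
  induction j with
  | zero => simp
  | succ j ih =>
    rw [Function.iterate_succ_apply', ih, Nat.descFactorial_succ]
    simp only [Derivation.leibniz, Derivation.leibniz_pow, hL, hb, hc, Derivation.map_natCast,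
      smul_zero, add_zero, smul_eq_mul, nsmul_eq_mul, mul_zero]
    rw [show n - (j + 1) = n - j - 1 by omega]
    push_cast
    ring

theorem choose_modEq_one (p : ℕ) (hp : p.Prime) (e : ℕ) :
    (2 * (p ^ e - 1) + 1).choose (p ^ e - 1) ≡ 1 [MOD p] := by
  have := Fact.mk hp
  induction e with
  | zero => simp [Nat.ModEq]
  | succ e ih =>
    obtain ⟨m, hm⟩ : ∃ m, p ^ e = m + 1 :=
      Nat.exists_eq_succ_of_ne_zero (pow_pos hp.pos e).ne'
    obtain ⟨r, hr⟩ : ∃ r, p = r + 1 := Nat.exists_eq_succ_of_ne_zero hp.ne_zero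
    have hq : p ^ (e + 1) - 1 = r + p * m := by
      rw [pow_succ, hm, hr]
      have : (m + 1) * (r + 1) = r + (r + 1) * m + 1 := by ring
      omega
    have h2 : 2 * (r + p * m) + 1 = r + p * (2 * m + 1) := by
      rw [hr]; ring
    have hrp : r < p := by omega
    rw [hm, Nat.add_sub_cancel] at ih
    rw [hq, h2]
    refine (Choose.choose_modEq_choose_mod_mul_choose_div_nat (p := p)).trans ?_
    rw [Nat.add_mul_mod_self_left, Nat.add_mul_mod_self_left, Nat.mod_eq_of_lt hrp,
      Nat.add_mul_div_left _ _ hp.pos, Nat.add_mul_div_left _ _ hp.pos, Nat.div_eq_of_lt hrp,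
      Nat.choose_self, one_mul, zero_add, zero_add]
    exact ih

theorem neg_one_pow_modEq (p : ℕ) (hp : p.Prime) (e : ℕ) :
    (-1 : ℤ) ^ (p ^ e - 1) ≡ 1 [ZMOD p] := by
  rcases hp.eq_two_or_odd' with h | h
  · subst h
    rcases neg_one_pow_eq_or ℤ (2 ^ e - 1) with h | h <;> rw [h]
    decide
  · have : Even (p ^ e - 1) := Nat.Odd.sub_odd h.pow odd_one
    rw [this.neg_one_pow]

/-- With `q = p^e`, `k = q - 1`, and `F = ∂u^k ∂y^k ∂z^k (u Δ2^k Δ3^k)`, there is a unique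
polynomial `P` with `(k!)^3 • P = F`, and `P ≡ u^q mod p`. -/
theorem divided_power_operator_on_first_term (p : ℕ) (hp : p.Prime) (e : ℕ)
    (q k : ℕ) (hq : q = p ^ e) (hk : k = q - 1)
    (F : MvPolynomial (Fin 6) ℤ)
    (hF : F = (⇑(pderiv (0 : Fin 6)))^[k] ((⇑(pderiv (4 : Fin 6)))^[k]
      ((⇑(pderiv (5 : Fin 6)))^[k] (U * Δ2 ^ k * Δ3 ^ k)))) :
    ∃! P : MvPolynomial (Fin 6) ℤ,
      ((k.factorial ^ 3 : ℕ) : ℤ) • P = F ∧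
        ∀ d : Fin 6 →₀ ℕ, ((p : ℤ)) ∣ (P - U ^ q).coeff d := by
  have h1 : (⇑(pderiv (5 : Fin 6)))^[k] (U * Δ2 ^ k * Δ3 ^ k) =
      ((k.factorial : MvPolynomial (Fin 6) ℤ) * (-U) ^ k * U) * Δ3 ^ k := by
    rw [show U * Δ2 ^ k * Δ3 ^ k = (U * Δ3 ^ k) * Δ2 ^ k by ring,
      iterate_deriv_pow (pderiv (5 : Fin 6)) (-U) (U * Δ3 ^ k) Δ2, Nat.descFactorial_self]
    · simp; ring
    · simp [Δ2, U, W, Xx, Zz, pderiv_X]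
    · simp [U, pderiv_X]
    · simp [Δ3, U, V, Xx, Yy, pderiv_X, Derivation.leibniz, Derivation.leibniz_pow]
  have h2 : (⇑(pderiv (4 : Fin 6)))^[k]
      (((k.factorial : MvPolynomial (Fin 6) ℤ) * (-U) ^ k * U) * Δ3 ^ k) =
      ((k.factorial : MvPolynomial (Fin 6) ℤ) ^ 2 * (-1) ^ k) * U ^ (2 * k + 1) := by
    rw [iterate_deriv_pow (pderiv (4 : Fin 6)) U _ Δ3, Nat.descFactorial_self]
    · rw [neg_pow U]; simp; ring
    · simp [Δ3, U, V, Xx, Yy, pderiv_X]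
    · simp [U, pderiv_X]
    · simp [U, pderiv_X, Derivation.leibniz, Derivation.leibniz_pow]
  have h3 : F = ((k.factorial ^ 3 : ℕ) : ℤ) •
      (C ((-1) ^ k * ((2 * k + 1).choose k : ℤ)) * U ^ (k + 1)) := by
    rw [hF, h1, h2, iterate_deriv_pow (pderiv (0 : Fin 6)) 1 _ U,
      Nat.descFactorial_eq_factorial_mul_choose, show 2 * k + 1 - k = k + 1 by omega]
    · rw [zsmul_eq_mul]
      simp
      ring
    · simp [U]
    · simp
    · simp [Derivation.leibniz, Derivation.leibniz_pow]
  have hkq : k + 1 = q := by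
    have := pow_pos hp.pos e
    omega
  have hmod : (-1) ^ k * ((2 * k + 1).choose k : ℤ) ≡ 1 [ZMOD p] := by
    have ha := neg_one_pow_modEq p hp e
    have hb := Int.natCast_modEq_iff.mpr (choose_modEq_one p hp e)
    rw [← hq, ← hk] at ha hb
    simpa using ha.mul hb
  refine ⟨C ((-1) ^ k * ((2 * k + 1).choose k : ℤ)) * U ^ (k + 1), ⟨h3.symm, ?_⟩, ?_⟩
  · intro d
    rw [← hkq, show ∀ a : ℤ, C a * U ^ (k + 1) - U ^ (k + 1) = C (a - 1) * U ^ (k + 1) by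
      intro a; simp; ring, coeff_C_mul]
    exact Dvd.dvd.mul_right hmod.symm.dvd _
  · rintro P ⟨hP, -⟩
    rw [h3] at hP
    refine smul_right_injective _ ?_ hP
    exact_mod_cast pow_ne_zero 3 k.factorial_ne_zero
end

section
/- Let R be a polynomial ring in finitely many variables over the ring of integers ℤ, let f₁, …, f_m ∈ R, and let n be a nonnegative integer. If a prime integer p is a nonzerodivisor on the Koszul cohomology module H^n(f₁, …, f_m; R), then p is a nonzerodivisor on the local cohomology module H^n_{(f₁,…,f_m)}(R). -/
open MvPolynomial

/-- The module of `n`-cochains of the Koszul complex on `m` elements of `R`: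
functions on the `n`-element subsets of `Fin m` (a model for `Λ^n (R^m)`,
with its dual/cochain indexing). -/
abbrev KoszulCochain (R : Type*) [CommRing R] (m n : ℕ) : Type _ :=
  {s : Finset (Fin m) // s.card = n} → R

/-- The Koszul differential `K^n(f; R) → K^{n+1}(f; R)` for a sequence
`f : Fin m → R`, given by `(d x)(t) = ∑_{i ∈ t} (-1)^{#{j ∈ t : j < i}} f i · x (t \ {i})`. -/
noncomputable def koszulD {R : Type*} [CommRing R] {m : ℕ} (f : Fin m → R) (n : ℕ) :
    KoszulCochain R m n →ₗ[R] KoszulCochain R m (n + 1) where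
  toFun x t := ∑ i ∈ t.1.attach,
    (-1 : R) ^ (t.1.filter (fun j => j < i.1)).card * f i.1 *
      x ⟨t.1.erase i.1, by rw [Finset.card_erase_of_mem i.2, t.2]; rfl⟩
  map_add' a b := by
    funext t
    simp [mul_add, Finset.sum_add_distrib]
  map_smul' r a := by
    funext t
    simp [Finset.mul_sum, mul_left_comm]

/-- The submodule of `n`-coboundaries of the Koszul complex: the image of the Koszul
differential from degree `n - 1`, interpreted as `⊥` in degree `0`. -/
noncomputable def koszulCoboundaries {R : Type*} [CommRing R] {m : ℕ} (f : Fin m → R) :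
    (n : ℕ) → Submodule R (KoszulCochain R m n)
  | 0 => ⊥
  | n + 1 => LinearMap.range (koszulD f n)

/-- The `n`-th Koszul cohomology `H^n(f₁, …, f_m; R)`: the `n`-cocycles modulo the
`n`-coboundaries. -/
noncomputable def koszulCohomology {R : Type*} [CommRing R] {m : ℕ} (f : Fin m → R)
    (n : ℕ) : Type _ :=
  LinearMap.ker (koszulD f n) ⧸
    Submodule.comap (LinearMap.ker (koszulD f n)).subtype (koszulCoboundaries f n)

noncomputable instance {R : Type*} [CommRing R] {m : ℕ} (f : Fin m → R) (n : ℕ) :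
    AddCommGroup (koszulCohomology f n) := by
  unfold koszulCohomology; infer_instance

noncomputable instance {R : Type*} [CommRing R] {m : ℕ} (f : Fin m → R) (n : ℕ) :
    Module R (koszulCohomology f n) := by
  unfold koszulCohomology; infer_instance

section
open CategoryTheory Limits Opposite


namespace PNLC
variable {R : Type} [CommRing R]

lemma homologyUnop_nat {K L : HomologicalComplex (ModuleCat.{0} R)ᵒᵖ (ComplexShape.down ℕ)} (ψ : K ⟶ L) (n : ℕ) :
    HomologicalComplex.homologyMap ((HomologicalComplex.unopFunctor _ _).map ψ.op) n ≫
      (HomologicalComplex.homologyUnop K n).hom =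
    (HomologicalComplex.homologyUnop L n).hom ≫ (HomologicalComplex.homologyMap ψ n).unop := by
  have := ShortComplex.homologyOpIso_hom_naturality
    (φ := (HomologicalComplex.shortComplexFunctor _ _ n).map ((HomologicalComplex.unopFunctor _ _).map ψ.op))
  apply Quiver.Hom.op_inj
  exact this.symm

/-- pullback of Hom complexes -/
noncomputable def homPull {P Q : ChainComplex (ModuleCat.{0} R) ℕ} (φ : P ⟶ Q) (M : ModuleCat.{0} R) :
    Q.linearYonedaObj R M ⟶ P.linearYonedaObj R M :=
  (HomologicalComplex.unopFunctor _ _).map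
    ((((linearYoneda R (ModuleCat.{0} R)).obj M).rightOp.mapHomologicalComplex _).map φ).op

lemma sq_aux {C : Type*} [Category* C] {A B A1 B1 A2 B2 : C} (x : A ⟶ B) (iB : B ≅ B1) (jB : B2 ≅ B1)
    (iA : A ≅ A1) (jA : A2 ≅ A1) (y : A1 ⟶ B1) (z : A2 ⟶ B2) (h1 : x ≫ iB.hom = iA.hom ≫ y)
    (h2 : z ≫ jB.hom = jA.hom ≫ y) : x ≫ (iB ≪≫ jB.symm).hom = (iA ≪≫ jA.symm).hom ≫ z := by
  have : y = jA.inv ≫ z ≫ jB.hom := by rw [h2, Iso.inv_hom_id_assoc]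
  simp [reassoc_of% h1, this]

lemma isoExt_nat {X Y : ModuleCat.{0} R} (g : X ⟶ Y) (P : ProjectiveResolution X)
    (Q : ProjectiveResolution Y) (φ : P.complex ⟶ Q.complex)
    (comm : φ.f 0 ≫ Q.π.f 0 = P.π.f 0 ≫ g) (n : ℕ) (M : ModuleCat.{0} R) :
    (((Ext R (ModuleCat.{0} R) n).map g.op).app M) ≫ (P.isoExt (R := R) n M).hom =
      (Q.isoExt (R := R) n M).hom ≫ HomologicalComplex.homologyMap (homPull φ M) n := by
  have h1 := ProjectiveResolution.isoLeftDerivedObj_inv_naturality g P Q φ comm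
    ((linearYoneda R (ModuleCat.{0} R)).obj M).rightOp n
  have h2 := homologyUnop_nat ((((linearYoneda R (ModuleCat.{0} R)).obj M).rightOp.mapHomologicalComplex _).map φ) n
  have h1' := congrArg Quiver.Hom.unop h1
  exact sq_aux _ (P.isoLeftDerivedObj ((linearYoneda R (ModuleCat R)).obj M).rightOp n).unop.symm
    _ (Q.isoLeftDerivedObj ((linearYoneda R (ModuleCat R)).obj M).rightOp n).unop.symm _ _ _ h1' h2

lemma cls_rep (K : CochainComplex (ModuleCat.{0} R) ℕ) (n : ℕ) (y : K.homology n) :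
    ∃ c : K.cycles n, K.homologyπ n c = y :=
  (ModuleCat.epi_iff_surjective (K.homologyπ n)).1 inferInstance y

lemma cyc_rep (K : CochainComplex (ModuleCat.{0} R) ℕ) (n : ℕ) (x : K.X n) (hx : K.d n (n+1) x = 0) :
    ∃ c : K.cycles n, K.iCycles n c = x := by
  have hex := (K.sc n).exact_iff_surjective_moduleCatToCycles
  have : (ShortComplex.mk (K.iCycles n) (K.d n (n+1)) (by simp)).Exact :=
    ShortComplex.exact_of_f_is_kernel _ (K.cyclesIsKernel n (n+1) (by simp))
  exact (ShortComplex.moduleCat_exact_iff _).1 this x hx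

lemma cls_zero_iff (K : CochainComplex (ModuleCat.{0} R) ℕ) (n : ℕ) (c : K.cycles n) :
    K.homologyπ n c = 0 ↔ ∃ w : K.X ((ComplexShape.up ℕ).prev n), K.d _ n w = K.iCycles n c := by
  have : (ShortComplex.mk (K.toCycles _ n) (K.homologyπ n) (K.toCycles_comp_homologyπ _ n)).Exact :=
    ShortComplex.exact_of_g_is_cokernel _ (K.homologyIsCokernel ((ComplexShape.up ℕ).prev n) n rfl)
  constructor
  · intro h
    obtain ⟨w, hw⟩ := (ShortComplex.moduleCat_exact_iff _).1 this c h
    refine ⟨w, ?_⟩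
    rw [← hw]
    exact (ConcreteCategory.congr_hom (K.toCycles_i ((ComplexShape.up ℕ).prev n) n) w).symm
  · rintro ⟨w, hw⟩
    have : c = K.toCycles _ n w := by
      apply (ModuleCat.mono_iff_injective (K.iCycles n)).1 inferInstance
      rw [← hw]
      exact (ConcreteCategory.congr_hom (K.toCycles_i ((ComplexShape.up ℕ).prev n) n) w).symm
    rw [this]
    exact ConcreteCategory.congr_hom (K.toCycles_comp_homologyπ ((ComplexShape.up ℕ).prev n) n) w

lemma cob_iff (P : ChainComplex (ModuleCat.{0} R) ℕ) (M : ModuleCat.{0} R) (n : ℕ) (x : P.X n ⟶ M) :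
    (∃ w : (P.linearYonedaObj R M).X ((ComplexShape.up ℕ).prev n),
      (P.linearYonedaObj R M).d _ n w = x) ↔ ∃ (j : ℕ) (w : P.X j ⟶ M), P.d n j ≫ w = x := by
  constructor
  · rintro ⟨w, hw⟩
    exact ⟨_, w, hw⟩
  · rintro ⟨j, w, hw⟩
    by_cases h : j + 1 = n
    · have : (ComplexShape.up ℕ).prev n = j := ComplexShape.prev_eq' _ h
      rw [this]
      exact ⟨w, hw⟩
    · rw [P.shape n j (by simpa using h), zero_comp] at hw
      exact ⟨0, by rw [map_zero]; exact hw⟩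

lemma ext_stage (J : Ideal R) (n : ℕ) (M : ModuleCat.{0} R) (p : R)
    (P : ∀ t : ℕ, ProjectiveResolution (ModuleCat.of R (R ⧸ J ^ t)))
    (H : ∀ (t : ℕ) (z : (P t).complex.X n ⟶ M), (P t).complex.d (n+1) n ≫ z = 0 →
      (∃ (j : ℕ) (w : (P t).complex.X j ⟶ M), (P t).complex.d n j ≫ w = p • z) →
      ∃ (t' : ℕ) (h : t ≤ t') (φ : (P t').complex ⟶ (P t).complex),
        φ.f 0 ≫ (P t).π.f 0 = (P t').π.f 0 ≫
          ModuleCat.ofHom (Submodule.mapQ _ _ LinearMap.id (Ideal.pow_le_pow_right h)) ∧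
        ∃ (j : ℕ) (w : (P t').complex.X j ⟶ M), (P t').complex.d n j ≫ w = φ.f n ≫ z)
    (t : ℕ) (e : ((Ext R (ModuleCat.{0} R) n).obj (op (ModuleCat.of R (R ⧸ J ^ t)))).obj M)
    (he : p • e = 0) :
    ∃ (t' : ℕ) (h : t ≤ t'), ((Ext R (ModuleCat.{0} R) n).map
      (ModuleCat.ofHom (Submodule.mapQ (J ^ t') (J ^ t) LinearMap.id
        (Ideal.pow_le_pow_right h))).op).app M e = 0 := by
  obtain ⟨c, hc⟩ := cls_rep _ n (((P t).isoExt (R := R) n M).hom e)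
  have hcz := (cls_zero_iff _ n (p • c)).1 (by
    rw [map_smul, hc, ← map_smul, he, map_zero])
  rw [map_smul] at hcz
  obtain ⟨t', h, φ, hφ, hw⟩ := H t ((((P t).complex.linearYonedaObj R M).iCycles n) c)
    (ConcreteCategory.congr_hom (((P t).complex.linearYonedaObj R M).iCycles_d n (n+1)) c)
    ((cob_iff _ _ _ _).1 hcz)
  refine ⟨t', h, ?_⟩
  have nat := ConcreteCategory.congr_hom (isoExt_nat _ (P t') (P t) φ hφ n M) e
  have inj : Function.Injective (((P t').isoExt (R := R) n M).hom) :=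
    (ModuleCat.mono_iff_injective _).1 inferInstance
  apply inj
  rw [map_zero]
  refine nat.trans ?_
  change HomologicalComplex.homologyMap (homPull φ M) n (((P t).isoExt (R := R) n M).hom e) = 0
  rw [← hc]
  refine (ConcreteCategory.congr_hom (HomologicalComplex.homologyπ_naturality (homPull φ M) n) c).trans ?_
  refine (cls_zero_iff _ n _).2 ((cob_iff _ _ _ _).2 ?_)
  obtain ⟨j, w, hw⟩ := hw
  refine ⟨j, w, hw.trans ?_⟩
  exact (ConcreteCategory.congr_hom (HomologicalComplex.cyclesMap_i (homPull φ M) n) c).symm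

lemma lc_stage (J : Ideal R) (n : ℕ) (M : ModuleCat.{0} R) (p : R)
    (H : ∀ (t : ℕ) (e : ((Ext R (ModuleCat.{0} R) n).obj (op (ModuleCat.of R (R ⧸ J ^ t)))).obj M)
    (_ : p • e = 0),
    ∃ (t' : ℕ) (h : t ≤ t'), ((Ext R (ModuleCat.{0} R) n).map
      (ModuleCat.ofHom (Submodule.mapQ (J ^ t') (J ^ t) LinearMap.id
        (Ideal.pow_le_pow_right h))).op).app M e = 0)
    (y : (localCohomology J n).obj M) (hy : p • y = 0) : y = 0 := by
  let F := localCohomology.diagram (localCohomology.idealPowersDiagram J) n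
  let iso := colimitObjIsoColimitCompEvaluation F M
  suffices key : ∀ y : ((colimit F).obj M : ModuleCat R), p • y = 0 → y = 0 from key y hy
  clear hy y
  intro y hy
  have inj : Function.Injective iso.hom :=
    (ModuleCat.mono_iff_injective _).1 inferInstance
  apply inj
  rw [map_zero]
  have hy' : p • iso.hom y = 0 := by
    rw [← map_smul, hy, map_zero]
  revert hy'
  generalize iso.hom y = y'
  intro hy'
  obtain ⟨t, e, rfl⟩ := Concrete.colimit_exists_rep (F ⋙ (evaluation _ _).obj M) y'
  rw [← map_smul] at hy'
  obtain ⟨t', i, hi⟩ := Concrete.colimit_rep_eq_zero (hx := hy')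
  rw [map_smul] at hi
  obtain ⟨t'', h, ht⟩ := H _ _ hi
  have e1 := ConcreteCategory.congr_hom (colimit.w (F ⋙ (evaluation _ _).obj M) i) e
  rw [← e1]
  let g : t' ⟶ op (op t'') := (homOfLE h).op.op
  have e2 := ConcreteCategory.congr_hom (colimit.w (F ⋙ (evaluation _ _).obj M) g)
    ((F ⋙ (evaluation _ _).obj M).map i e)
  refine Eq.trans (Eq.trans rfl e2.symm) ?_
  refine Eq.trans (congrArg (colimit.ι (F ⋙ (evaluation _ _).obj M) (op (op t''))) ht) (map_zero _)

end PNLC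
end

section
namespace PNLC

/-- A pro-system of complexes of projective modules, together with the degree zero
homology `R ⧸ a t`, whose ideals `a t` are cofinal with the powers of `J`. -/
structure ProCx (R : Type) [CommRing R] (J : Ideal R) where
  Q : ℕ → ℕ → Type
  [acg : ∀ t n, AddCommGroup (Q t n)]
  [mod : ∀ t n, Module R (Q t n)]
  d : ∀ t n, Q t (n+1) →ₗ[R] Q t n
  proj : ∀ t n, Module.Projective R (Q t n)
  dd : ∀ t n x, d t n (d t (n+1) x) = 0
  a : ℕ → Ideal R
  ε : ∀ t, Q t 0 →ₗ[R] R ⧸ a t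
  ε_surj : ∀ t, Function.Surjective (ε t)
  ε_exact : ∀ t x, ε t x = 0 ↔ ∃ y, d t 0 y = x
  Adm : ∀ t' t, (∀ n, Q t' n →ₗ[R] Q t n) → Prop
  adm_comp : ∀ t'' t' t φ ψ, Adm t'' t' φ → Adm t' t ψ → Adm t'' t (fun n => ψ n ∘ₗ φ n)
  adm_d : ∀ t' t φ, Adm t' t φ → ∀ n x, φ n (d t' n x) = d t n (φ (n+1) x)
  adm_ε : ∀ t' t φ, Adm t' t φ → ∀ (r : R) x, ε t' x = Ideal.Quotient.mk _ r →
    ε t (φ 0 x) = Ideal.Quotient.mk _ r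
  cof1 : ∀ t, ∃ k, J ^ k ≤ a t
  cof2 : ∀ t k, ∃ t' φ, Adm t' t φ ∧ a t' ≤ J ^ k

attribute [instance] ProCx.acg ProCx.mod

variable {R : Type} [CommRing R] {J : Ideal R}

namespace ProCx
variable (S : ProCx R J)

/-- `p` is injective on the cohomology in degree `n+1` with coefficients in `M`. -/
def Inj (p : R) (n : ℕ) (M : Type) [AddCommGroup M] [Module R M] : Prop :=
  ∀ t (z : S.Q t (n+1) →ₗ[R] M) (w : S.Q t n →ₗ[R] M), z ∘ₗ S.d t (n+1) = 0 →
    p • z = w ∘ₗ S.d t n → ∃ r φ, S.Adm r t φ ∧ ∃ v : S.Q r n →ₗ[R] M,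
      z ∘ₗ φ (n+1) = v ∘ₗ S.d r n

/-- The cohomology in degree `n+1` with coefficients in `M` vanishes. -/
def Van (n : ℕ) (M : Type) [AddCommGroup M] [Module R M] : Prop :=
  ∀ t (z : S.Q t (n+1) →ₗ[R] M), z ∘ₗ S.d t (n+1) = 0 →
    ∃ r φ, S.Adm r t φ ∧ ∃ v : S.Q r n →ₗ[R] M,
      z ∘ₗ φ (n+1) = v ∘ₗ S.d r n

variable {A I C : Type} [AddCommGroup A] [Module R A] [AddCommGroup I] [Module R I]
  [AddCommGroup C] [Module R C] 

lemma factor {N : Type} [AddCommGroup N] [Module R N] {i : A →ₗ[R] I} {π : I →ₗ[R] C}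
    (hi : Function.Injective i) (hex : Function.Exact i π)
    (h : N →ₗ[R] I) (hh : π ∘ₗ h = 0) : ∃ a : N →ₗ[R] A, i ∘ₗ a = h := by
  have hr : ∀ x, h x ∈ LinearMap.range i := fun x => (hex (h x)).1 (LinearMap.congr_fun hh x)
  refine ⟨(LinearEquiv.ofInjective i hi).symm.toLinearMap ∘ₗ h.codRestrict _ hr, ?_⟩
  ext x
  have := (LinearEquiv.ofInjective i hi).apply_symm_apply (h.codRestrict _ hr x)
  simp

lemma inj_up {p : R} {n : ℕ} {i : A →ₗ[R] I} {π : I →ₗ[R] C}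
    (hi : Function.Injective i) (hex : Function.Exact i π) (hπ : Function.Surjective π)
    (hv1 : S.Van n I) (hv2 : S.Van (n+1) I) (h : S.Inj p n C) : S.Inj p (n+1) A := by
  intro t z w hz hw
  have hpi : π ∘ₗ i = 0 := LinearMap.ext fun x => hex.apply_apply_eq_zero x
  obtain ⟨t1, φ1, hφ1, y, hy⟩ := hv2 t (i ∘ₗ z) (by rw [LinearMap.comp_assoc, hz, LinearMap.comp_zero])
  -- p y - i w is a cocycle
  obtain ⟨t2, φ2, hφ2, v, hv⟩ := hv1 t1 (p • y - i ∘ₗ w ∘ₗ φ1 (n+1)) (by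
    ext x
    have h1 := LinearMap.congr_fun hy x
    have h2 := LinearMap.congr_fun hw (φ1 (n+2) x)
    simp only [LinearMap.comp_apply, LinearMap.smul_apply, LinearMap.sub_apply,
      LinearMap.zero_apply] at h1 h2 ⊢
    rw [← h1, S.adm_d _ _ _ hφ1, ← h2, map_smul, sub_self])
  obtain ⟨t3, φ3, hφ3, x, hx⟩ := h t2 (π ∘ₗ y ∘ₗ φ2 (n+1)) (π ∘ₗ v) (by
    ext q
    have h1 := LinearMap.congr_fun hy (φ2 (n+2) q)
    simp only [LinearMap.comp_apply, LinearMap.zero_apply] at h1 ⊢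
    rw [S.adm_d _ _ _ hφ2, ← h1]
    exact LinearMap.congr_fun hpi _) (by
    ext q
    have h1 := LinearMap.congr_fun hv q
    simp only [LinearMap.comp_apply, LinearMap.smul_apply, LinearMap.sub_apply] at h1 ⊢
    rw [← h1, map_sub, map_smul, show π (i _) = 0 from LinearMap.congr_fun hpi _, sub_zero])
  have := S.proj t3 n
  obtain ⟨x', hx'⟩ := Module.projective_lifting_property π x hπ
  obtain ⟨a, ha⟩ := factor hi hex (y ∘ₗ φ2 (n+1) ∘ₗ φ3 (n+1) - x' ∘ₗ S.d t3 n) (by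
    ext q
    have h1 := LinearMap.congr_fun hx q
    have h2 := LinearMap.congr_fun hx' (S.d t3 n q)
    simp only [LinearMap.comp_apply, LinearMap.sub_apply, LinearMap.zero_apply, map_sub] at h1 h2 ⊢
    rw [h1, h2, sub_self])
  refine ⟨t3, _, S.adm_comp _ _ _ _ _ hφ3 (S.adm_comp _ _ _ _ _ hφ2 hφ1), a, ?_⟩
  ext q
  apply hi
  have h1 := LinearMap.congr_fun ha (S.d t3 (n+1) q)
  have h2 := LinearMap.congr_fun hy (φ2 (n+2) (φ3 (n+2) q))
  simp only [LinearMap.comp_apply, LinearMap.sub_apply, S.dd, map_zero, sub_zero] at h1 h2 ⊢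
  rw [h1, h2, S.adm_d _ _ _ hφ3, S.adm_d _ _ _ hφ2]

lemma inj_down {p : R} {n : ℕ} {i : A →ₗ[R] I} {π : I →ₗ[R] C}
    (hi : Function.Injective i) (hex : Function.Exact i π) (hπ : Function.Surjective π)
    (hv1 : S.Van n I) (h : S.Inj p (n+1) A) : S.Inj p n C := by
  intro t c x hc hx
  have hpi : ∀ a, π (i a) = 0 := hex.apply_apply_eq_zero
  have := S.proj t (n+1)
  have := S.proj t n
  obtain ⟨y, hy⟩ := Module.projective_lifting_property π c hπ
  obtain ⟨x', hx'⟩ := Module.projective_lifting_property π x hπ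
  obtain ⟨z, hz⟩ := factor hi hex (y ∘ₗ S.d t (n+1)) (by
    rw [← LinearMap.comp_assoc, hy, hc])
  obtain ⟨w, hw⟩ := factor hi hex (p • y - x' ∘ₗ S.d t n) (by
    rw [LinearMap.comp_sub, LinearMap.comp_smul, ← LinearMap.comp_assoc, hy, hx', hx, sub_self])
  obtain ⟨t1, φ1, hφ1, a, ha⟩ := h t z w (by
    ext q
    apply hi
    have h1 := LinearMap.congr_fun hz (S.d t (n+2) q)
    simpa [S.dd] using h1) (by
    ext q
    apply hi
    have h1 := LinearMap.congr_fun hz q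
    have h2 := LinearMap.congr_fun hw (S.d t (n+1) q)
    simp only [LinearMap.comp_apply, LinearMap.sub_apply, LinearMap.smul_apply, S.dd, map_zero,
      sub_zero, map_smul] at h1 h2 ⊢
    rw [h2, h1])
  obtain ⟨t2, φ2, hφ2, v, hv⟩ := hv1 t1 (y ∘ₗ φ1 (n+1) - i ∘ₗ a) (by
    ext q
    have h1 := LinearMap.congr_fun ha q
    have h2 := LinearMap.congr_fun hz (φ1 (n+2) q)
    simp only [LinearMap.comp_apply, LinearMap.sub_apply, LinearMap.zero_apply] at h1 h2 ⊢
    rw [← h1, h2, S.adm_d _ _ _ hφ1, sub_self])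
  refine ⟨t2, _, S.adm_comp _ _ _ _ _ hφ2 hφ1, π ∘ₗ v, ?_⟩
  rw [LinearMap.comp_assoc, ← hv, ← hy]
  ext q
  simp [hpi]

/-- torsion elements -/
def Tors (J : Ideal R) {M : Type} [AddCommGroup M] [Module R M] (m : M) : Prop :=
  ∃ k, ∀ r ∈ J ^ k, r • m = 0

/-- The relative condition. -/
def Rel (J : Ideal R) (p : R) (π : I →ₗ[R] C) : Prop :=
  ∀ c, Tors J c → (∃ b, Tors J b ∧ π b = p • c) → ∃ b, Tors J b ∧ π b = c

/-- the zero cocycle attached to an element. -/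
lemma cocyc_of {M : Type} [AddCommGroup M] [Module R M] (t : ℕ) (m : M) 
    (hm : ∀ r ∈ S.a t, r • m = 0) : ∃ z : S.Q t 0 →ₗ[R] M, z ∘ₗ S.d t 0 = 0 ∧
      ∀ (r : R) x, S.ε t x = Ideal.Quotient.mk _ r → z x = r • m := by
  refine ⟨(Submodule.liftQ (S.a t) (LinearMap.toSpanSingleton R M m) (fun r hr => hm r hr)) ∘ₗ S.ε t, ?_, ?_⟩
  · ext x
    have : S.ε t (S.d t 0 x) = 0 := (S.ε_exact _ _).2 ⟨x, rfl⟩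
    simp [this]
  · intro r x hx
    rw [LinearMap.comp_apply, hx]
    exact Submodule.liftQ_apply _ _ _

lemma elem_of {M : Type} [AddCommGroup M] [Module R M] (t : ℕ) (z : S.Q t 0 →ₗ[R] M)
    (hz : z ∘ₗ S.d t 0 = 0) : ∃ m : M, (∀ r ∈ S.a t, r • m = 0) ∧
      ∀ (r : R) x, S.ε t x = Ideal.Quotient.mk _ r → z x = r • m := by
  obtain ⟨x0, hx0⟩ := S.ε_surj t (Ideal.Quotient.mk _ 1)
  have key : ∀ (r : R) x, S.ε t x = Ideal.Quotient.mk _ r → z x = r • z x0 := by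
    intro r x hx
    have : S.ε t (x - r • x0) = 0 := by
      rw [map_sub, map_smul, hx, hx0, sub_eq_zero]
      change _ = Ideal.Quotient.mk _ (r • (1:R))
      simp
    obtain ⟨y, hy⟩ := (S.ε_exact _ _).1 this
    have h1 := LinearMap.congr_fun hz y
    rw [LinearMap.comp_apply, hy, map_sub, map_smul] at h1
    exact sub_eq_zero.1 h1
  refine ⟨z x0, fun r hr => ?_, key⟩
  rw [← key r 0, map_zero]
  rw [map_zero, eq_comm]
  exact Ideal.Quotient.eq_zero_iff_mem.2 hr

lemma cocyc_ext {M : Type} [AddCommGroup M] [Module R M] {t : ℕ} {z z' : S.Q t 0 →ₗ[R] M} {m : M}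
    (h : ∀ (r : R) x, S.ε t x = Ideal.Quotient.mk _ r → z x = r • m) 
    (h' : ∀ (r : R) x, S.ε t x = Ideal.Quotient.mk _ r → z' x = r • m) : z = z' := by
  ext x
  obtain ⟨r, hr⟩ := Ideal.Quotient.mk_surjective (S.ε t x)
  rw [h r x hr.symm, h' r x hr.symm]

lemma tors_stage {M : Type} [AddCommGroup M] [Module R M] {m : M} (hm : Tors J m) (t : ℕ) :
    ∃ t' φ, S.Adm t' t φ ∧ ∀ r ∈ S.a t', r • m = 0 := by
  obtain ⟨k, hk⟩ := hm
  obtain ⟨t', φ, h, hle⟩ := S.cof2 t k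
  exact ⟨t', φ, h, fun r hr => hk r (hle hr)⟩

lemma stage_tors {M : Type} [AddCommGroup M] [Module R M] {m : M} {t : ℕ}
    (hm : ∀ r ∈ S.a t, r • m = 0) : Tors J m := by
  obtain ⟨k, hk⟩ := S.cof1 t
  exact ⟨k, fun r hr => hm r (hk hr)⟩

lemma ε_one (t : ℕ) : ∃ x, S.ε t x = Ideal.Quotient.mk _ 1 := S.ε_surj t _

lemma tors_mono {M : Type} [AddCommGroup M] [Module R M] {m : M} {k l : ℕ} (h : k ≤ l)
    (hm : ∀ r ∈ J ^ k, r • m = 0) : ∀ r ∈ J ^ l, r • m = 0 :=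
  fun r hr => hm r (Ideal.pow_le_pow_right h hr)

lemma inj_zero_iff {p : R} {i : A →ₗ[R] I} {π : I →ₗ[R] C}
    (hi : Function.Injective i) (hex : Function.Exact i π) (hπ : Function.Surjective π)
    (hv : S.Van 0 I) : S.Inj p 0 A ↔ Rel J p π := by
  have hpi : ∀ a, π (i a) = 0 := hex.apply_apply_eq_zero
  constructor
  · rintro h c ⟨k1, hk1⟩ ⟨b, ⟨k2, hk2⟩, hb⟩
    obtain ⟨t, _, _, hle⟩ := S.cof2 0 (max k1 k2)
    obtain ⟨c', hc', hc''⟩ := S.cocyc_of t c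
      (fun r hr => tors_mono (le_max_left _ _) hk1 r (hle hr))
    obtain ⟨b', hb', hb''⟩ := S.cocyc_of t b
      (fun r hr => tors_mono (le_max_right _ _) hk2 r (hle hr))
    have hbc : π ∘ₗ b' = p • c' := by
      apply S.cocyc_ext (m := p • c)
      · intro r x hx
        rw [LinearMap.comp_apply, hb'' r x hx, map_smul, hb]
      · intro r x hx
        rw [LinearMap.smul_apply, hc'' r x hx, smul_comm]
    have := S.proj t 0
    obtain ⟨y, hy⟩ := Module.projective_lifting_property π c' hπ
    obtain ⟨z, hz⟩ := factor hi hex (y ∘ₗ S.d t 0) (by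
      rw [← LinearMap.comp_assoc, hy, hc'])
    obtain ⟨w, hw⟩ := factor hi hex (p • y - b') (by
      rw [LinearMap.comp_sub, LinearMap.comp_smul, hy, hbc, sub_self])
    obtain ⟨t1, φ1, hφ1, a, ha⟩ := h t z w (by
      ext q
      apply hi
      have h1 := LinearMap.congr_fun hz (S.d t 1 q)
      simpa [S.dd] using h1) (by
      ext q
      apply hi
      have h1 := LinearMap.congr_fun hz q
      have h2 := LinearMap.congr_fun hw (S.d t 0 q)
      have h3 := LinearMap.congr_fun hb' q
      simp only [LinearMap.comp_apply, LinearMap.sub_apply, LinearMap.smul_apply, 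
        map_smul, LinearMap.zero_apply] at h1 h2 h3 ⊢
      rw [h2, h1, h3, sub_zero])
    obtain ⟨m, hm, hm'⟩ := S.elem_of t1 (y ∘ₗ φ1 0 - i ∘ₗ a) (by
      ext q
      have h1 := LinearMap.congr_fun ha q
      have h2 := LinearMap.congr_fun hz (φ1 1 q)
      simp only [LinearMap.comp_apply, LinearMap.sub_apply, LinearMap.zero_apply] at h1 h2 ⊢
      rw [← h1, h2, S.adm_d _ _ _ hφ1, sub_self])
    refine ⟨m, S.stage_tors hm, ?_⟩
    obtain ⟨x, hx⟩ := S.ε_one t1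
    have h1 := hm' 1 x hx
    rw [one_smul] at h1
    rw [← h1]
    have h2 := hc'' 1 _ (S.adm_ε _ _ _ hφ1 1 x hx)
    rw [one_smul, ← hy] at h2
    simpa [hpi] using h2
  · intro h t z w hz hw
    obtain ⟨t1, φ1, hφ1, y, hy⟩ := hv t (i ∘ₗ z) (by
      rw [LinearMap.comp_assoc, hz, LinearMap.comp_zero])
    obtain ⟨c, hc, hc'⟩ := S.elem_of t1 (π ∘ₗ y) (by
      rw [LinearMap.comp_assoc, ← hy]
      ext q
      simp [hpi])
    obtain ⟨b, hb, hb'⟩ := S.elem_of t1 (p • y - i ∘ₗ w ∘ₗ φ1 0) (by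
      ext x
      have h1 := LinearMap.congr_fun hy x
      have h2 := LinearMap.congr_fun hw (φ1 1 x)
      simp only [LinearMap.comp_apply, LinearMap.smul_apply, LinearMap.sub_apply,
        LinearMap.zero_apply] at h1 h2 ⊢
      rw [← h1, S.adm_d _ _ _ hφ1, ← h2, map_smul, sub_self])
    obtain ⟨x1, hx1⟩ := S.ε_one t1
    obtain ⟨e, he, he'⟩ := h c (S.stage_tors hc) ⟨b, S.stage_tors hb, by
      have h1 := hb' 1 x1 hx1
      have h2 := hc' 1 x1 hx1
      rw [one_smul] at h1 h2
      rw [← h1, ← h2]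
      simp [hpi]⟩
    obtain ⟨t2, φ2, hφ2, ht2⟩ := S.tors_stage he t1
    obtain ⟨e', he1, he2⟩ := S.cocyc_of t2 e ht2
    obtain ⟨a, ha⟩ := factor hi hex (y ∘ₗ φ2 0 - e') (by
      rw [LinearMap.comp_sub, sub_eq_zero]
      apply S.cocyc_ext (m := c)
      · intro r x hx
        exact hc' r _ (S.adm_ε _ _ _ hφ2 r x hx)
      · intro r x hx
        rw [LinearMap.comp_apply, he2 r x hx, map_smul, he'])
    refine ⟨t2, _, S.adm_comp _ _ _ _ _ hφ2 hφ1, a, ?_⟩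
    ext q
    apply hi
    have h1 := LinearMap.congr_fun ha (S.d t2 0 q)
    have h2 := LinearMap.congr_fun hy (φ2 1 q)
    have h3 := LinearMap.congr_fun he1 q
    simp only [LinearMap.comp_apply, LinearMap.sub_apply, LinearMap.zero_apply] at h1 h2 h3 ⊢
    rw [h1, h2, h3, sub_zero, S.adm_d _ _ _ hφ2]

end ProCx

open CategoryTheory in
lemma exists_inj_embed (M : Type) [AddCommGroup M] [Module R M] :
    ∃ (I : Type) (_ : AddCommGroup I) (_ : Module R I) (i : M →ₗ[R] I),
      Function.Injective i ∧ Module.Injective R I := by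
  refine ⟨ModuleCat.carrier (Injective.under (ModuleCat.of R M) : ModuleCat R), inferInstance,
    inferInstance, (Injective.ι (ModuleCat.of R M)).hom, ?_, ?_⟩
  · exact (ModuleCat.mono_iff_injective _).1 inferInstance
  · have h : Injective (Injective.under (ModuleCat.of R M)) := inferInstance
    exact Module.injective_module_of_injective_object R _ (inj := h)

theorem ProCx.transfer (S T : ProCx R J) (p : R)
    (hS : ∀ (n : ℕ) (I : Type) [AddCommGroup I] [Module R I], Module.Injective R I → S.Van n I)
    (hT : ∀ (n : ℕ) (I : Type) [AddCommGroup I] [Module R I], Module.Injective R I → T.Van n I)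
    (n : ℕ) : ∀ (M : Type) [AddCommGroup M] [Module R M], S.Inj p n M → T.Inj p n M := by
  induction n with
  | zero =>
    intro M _ _ h
    obtain ⟨I, _, _, i, hi, hI⟩ := exists_inj_embed (R := R) M
    have hex : Function.Exact i (LinearMap.range i).mkQ := LinearMap.exact_map_mkQ_range i
    have hπ := (LinearMap.range i).mkQ_surjective
    rw [T.inj_zero_iff hi hex hπ (hT _ _ hI)]
    exact (S.inj_zero_iff hi hex hπ (hS _ _ hI)).1 h
  | succ n ih =>
    intro M _ _ h
    obtain ⟨I, _, _, i, hi, hI⟩ := exists_inj_embed (R := R) M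
    have hex : Function.Exact i (LinearMap.range i).mkQ := LinearMap.exact_map_mkQ_range i
    have hπ := (LinearMap.range i).mkQ_surjective
    exact T.inj_up hi hex hπ (hT _ _ hI) (hT _ _ hI)
      (ih _ (S.inj_down hi hex hπ (hS _ _ hI) h))

end PNLC
end

section
open CategoryTheory Limits Opposite

namespace PNLC
variable {R : Type} [CommRing R]

/-- the augmentation of a projective resolution -/
noncomputable def augm {Z : ModuleCat.{0} R} (P : ProjectiveResolution Z) : P.complex.X 0 ⟶ Z :=
  P.π.f 0

lemma augm_surj {Z : ModuleCat.{0} R} (P : ProjectiveResolution Z) :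
    Function.Surjective (augm P).hom := by
  have : Epi (augm P) := inferInstanceAs (Epi (P.π.f 0))
  exact (ModuleCat.epi_iff_surjective _).1 this

lemma augm_exact {Z : ModuleCat.{0} R} (P : ProjectiveResolution Z) (x : P.complex.X 0) :
    (augm P).hom x = 0 ↔ ∃ y, (P.complex.d 1 0).hom y = x := by
  constructor
  · intro h
    exact (ShortComplex.moduleCat_exact_iff _).1 P.exact₀ x h
  · rintro ⟨y, rfl⟩
    exact ConcreteCategory.congr_hom P.complex_d_comp_π_f_zero y

/-- The projection between quotients by powers. -/
noncomputable def powProj (J : Ideal R) {t t' : ℕ} (h : t ≤ t') :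
    ModuleCat.of R (R ⧸ J ^ t') ⟶ ModuleCat.of R (R ⧸ J ^ t) :=
  ModuleCat.ofHom (Submodule.mapQ _ _ LinearMap.id (Ideal.pow_le_pow_right h))

lemma powProj_mk (J : Ideal R) {t t' : ℕ} (h : t ≤ t') (r : R) :
    (powProj J h).hom (Ideal.Quotient.mk _ r) = Ideal.Quotient.mk _ r := rfl

/-- Pro-complex from resolutions. -/
noncomputable def resPro (J : Ideal R)
    (P : ∀ t : ℕ, ProjectiveResolution (ModuleCat.of R (R ⧸ J ^ t))) : ProCx R J where
  Q t n := (P t).complex.X n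
  d t n := ((P t).complex.d (n+1) n).hom
  proj t n := by
    have h := (P t).projective n
    exact (IsProjective.iff_projective _).2 h
  dd t n x := ConcreteCategory.congr_hom ((P t).complex.d_comp_d (n+2) (n+1) n) x
  a t := J ^ t
  ε t := (augm (P t)).hom
  ε_surj t := augm_surj (P t)
  ε_exact t x := augm_exact (P t) x
  Adm t' t φ := ∃ (h : t ≤ t') (ψ : (P t').complex ⟶ (P t).complex),
    ψ.f 0 ≫ augm (P t) = augm (P t') ≫ powProj J h ∧ ∀ n, φ n = (ψ.f n).hom
  adm_comp := by
    rintro t'' t' t φ ψ ⟨h1, φ', h2, h3⟩ ⟨h4, ψ', h5, h6⟩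
    refine ⟨h4.trans h1, φ' ≫ ψ', ?_, fun n => by
      change ψ n ∘ₗ φ n = _
      rw [h3, h6]; rfl⟩
    rw [HomologicalComplex.comp_f, Category.assoc, h5, ← Category.assoc, h2, Category.assoc]
    congr 1
    apply ModuleCat.hom_ext
    apply LinearMap.ext
    intro x
    obtain ⟨r, rfl⟩ := Ideal.Quotient.mk_surjective x
    rfl
  adm_d := by
    rintro t' t φ ⟨h1, φ', h2, h3⟩ n x
    rw [h3, h3]
    exact (ConcreteCategory.congr_hom (φ'.comm (n+1) n) x).symm
  adm_ε := by
    rintro t' t φ ⟨h1, φ', h2, h3⟩ r x hx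
    rw [h3]
    refine (ConcreteCategory.congr_hom h2 x).trans ?_
    exact congrArg (powProj J h1).hom hx
  cof1 t := ⟨t, le_rfl⟩
  cof2 t k := ⟨max t k, fun n => ((ProjectiveResolution.lift (powProj J (le_max_left t k))
    (P (max t k)) (P t)).f n).hom, ⟨le_max_left _ _, _, by
      exact ProjectiveResolution.lift_commutes_zero _ _ _, fun n => rfl⟩,
      Ideal.pow_le_pow_right (le_max_right t k)⟩

lemma resPro_van (J : Ideal R)
    (P : ∀ t : ℕ, ProjectiveResolution (ModuleCat.of R (R ⧸ J ^ t)))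
    (n : ℕ) (I : Type) [AddCommGroup I] [Module R I] (hI : Module.Injective R I) :
    (resPro J P).Van n I := by
  intro t z hz
  refine ⟨t, fun n => LinearMap.id, ⟨le_rfl, 𝟙 _, ?_, fun n => rfl⟩, ?_⟩
  · rw [HomologicalComplex.id_f, Category.id_comp]
    ext x
    obtain ⟨r, hr⟩ := Ideal.Quotient.mk_surjective ((augm (P t)).hom x)
    change (augm (P t)).hom x = (powProj J le_rfl).hom ((augm (P t)).hom x)
    rw [← hr]
    rfl
  · let D := (resPro J P).d t n
    have hker : LinearMap.ker D ≤ LinearMap.ker z := by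
      intro x hx
      obtain ⟨y, hy⟩ := (ShortComplex.moduleCat_exact_iff _).1 ((P t).exact_succ n) x hx
      have := LinearMap.congr_fun hz y
      rw [LinearMap.mem_ker, ← hy]
      exact this
    obtain ⟨v, hv⟩ := hI.out ((LinearMap.ker D).liftQ D le_rfl)
      (by rw [← LinearMap.ker_eq_bot, Submodule.ker_liftQ_eq_bot' _ _ rfl])
      ((LinearMap.ker D).liftQ z hker)
    refine ⟨v, ?_⟩
    ext x
    have := hv (Submodule.Quotient.mk x)
    rw [Submodule.liftQ_apply, Submodule.liftQ_apply] at this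
    exact this.symm

/-- Injectivity of multiplication by `p` on local cohomology, from the pro-complex. -/
lemma lc_of_inj (J : Ideal R) (n : ℕ) (M : ModuleCat.{0} R) (p : R)
    (P : ∀ t : ℕ, ProjectiveResolution (ModuleCat.of R (R ⧸ J ^ t)))
    (H : (resPro J P).Inj p n M) 
    (y : (localCohomology J (n+1)).obj M) (hy : p • y = 0) : y = 0 := by
  refine lc_stage J (n+1) M p (ext_stage J (n+1) M p P ?_) y hy
  rintro t z hz ⟨j, w, hw⟩
  have : ∃ w' : (P t).complex.X n ⟶ M, p • z = (P t).complex.d (n+1) n ≫ w' := by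
    by_cases hj : j = n
    · subst hj; exact ⟨w, hw.symm⟩
    · refine ⟨0, ?_⟩
      rw [← hw, (P t).complex.shape (n+1) j (by simpa using hj), zero_comp, comp_zero]
  obtain ⟨w', hw'⟩ := this
  obtain ⟨t', φ, ⟨h, ψ, h1, h2⟩, v, hv⟩ := H t z.hom w'.hom (by
    ext x
    exact ConcreteCategory.congr_hom hz x) (by
    ext x
    exact ConcreteCategory.congr_hom hw' x)
  refine ⟨t', h, ψ, h1, n, ModuleCat.ofHom v, ?_⟩
  ext x
  rw [h2] at hv
  exact (LinearMap.congr_fun hv x).symm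

lemma lc_zero (J : Ideal R) (M : ModuleCat.{0} R) (p : R) (hp : ∀ m : M, p • m = 0 → m = 0)
    (y : (localCohomology J 0).obj M) (hy : p • y = 0) : y = 0 := by
  have P : ∀ t : ℕ, ProjectiveResolution (ModuleCat.of R (R ⧸ J ^ t)) := fun t => .of _
  refine lc_stage J 0 M p (ext_stage J 0 M p P ?_) y hy
  rintro t z hz ⟨j, w, hw⟩
  have hz0 : z = 0 := by
    rw [(P t).complex.shape 0 j (by simp), zero_comp] at hw
    ext x
    apply hp
    exact (ConcreteCategory.congr_hom hw x).symm
  refine ⟨t, le_rfl, 𝟙 _, ?_, 0, 0, ?_⟩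
  · rw [HomologicalComplex.id_f, Category.id_comp]
    change augm (P t) = augm (P t) ≫ powProj J le_rfl
    ext x
    obtain ⟨r, hr⟩ := Ideal.Quotient.mk_surjective ((augm (P t)).hom x)
    change (augm (P t)).hom x = (powProj J le_rfl).hom ((augm (P t)).hom x)
    rw [← hr]
    rfl
  · rw [hz0, comp_zero, comp_zero]

end PNLC
end

section
namespace PNLC
variable {R : Type*} [CommRing R] {m : ℕ}

/-- comparison sign -/
def cmpSg (R : Type*) [CommRing R] (i j : Fin m) : R := if j < i then -1 else 1

/-- Koszul sign of `i` in `t`. -/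
def sg (R : Type*) [CommRing R] (i : Fin m) (t : Finset (Fin m)) : R :=
  ∏ j ∈ t, cmpSg R i j

lemma sg_eq (i : Fin m) (t : Finset (Fin m)) :
    sg R i t = (-1 : R) ^ (t.filter (fun j => j < i)).card := by
  unfold sg cmpSg
  rw [Finset.prod_ite]
  simp

lemma cmpSg_mul_self (i j : Fin m) : cmpSg R i j * cmpSg R i j = 1 := by
  unfold cmpSg; split_ifs <;> simp

lemma sg_mul_self (i : Fin m) (t : Finset (Fin m)) : sg R i t * sg R i t = 1 := by
  unfold sg
  rw [← Finset.prod_mul_distrib]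
  simp [cmpSg_mul_self]

lemma sg_erase (i j : Fin m) (t : Finset (Fin m)) (hi : i ∈ t) :
    sg R j (t.erase i) = cmpSg R j i * sg R j t := by
  unfold sg
  rw [← Finset.mul_prod_erase t _ hi, ← mul_assoc, cmpSg_mul_self, one_mul]

lemma cmpSg_swap {i j : Fin m} (h : i ≠ j) : cmpSg R i j = - cmpSg R j i := by
  unfold cmpSg
  rcases lt_or_gt_of_ne h with h | h
  · simp [h, not_lt.2 h.le]
  · simp [h, not_lt.2 h.le]

lemma map_sg {R' : Type*} [CommRing R'] (φ : R →+* R') (i : Fin m) (t : Finset (Fin m)) :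
    φ (sg R i t) = sg R' i t := by
  rw [sg_eq, sg_eq]; simp

section
variable {M N : Type*} [AddCommGroup M] [Module R M] [AddCommGroup N] [Module R N]

/-- Total Koszul differential. -/
def kd (g : Fin m → R) (x : Finset (Fin m) → M) : Finset (Fin m) → M :=
  fun t => ∑ i ∈ t, (sg R i t * g i) • x (t.erase i)

lemma kd_kd (g : Fin m → R) (x : Finset (Fin m) → M) : kd g (kd g x) = 0 := by
  funext t
  simp only [kd, Finset.smul_sum, smul_smul, Pi.zero_apply]
  rw [Finset.sum_sigma']
  refine Finset.sum_involution (fun q _ => ⟨q.2, q.1⟩) ?_ ?_ ?_ ?_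
  · rintro ⟨i, j⟩ h
    simp only [Finset.mem_sigma, Finset.mem_erase] at h
    rw [sg_erase i j t h.1, sg_erase j i t h.2.2, cmpSg_swap h.2.1, Finset.erase_right_comm, ← add_smul]
    convert zero_smul R _
    ring
  · rintro ⟨i, j⟩ h _ hh
    simp only [Finset.mem_sigma, Finset.mem_erase] at h
    exact h.2.1 (by simpa using (congrArg (fun q => q.1) hh))
  · rintro ⟨i, j⟩ h
    simp only [Finset.mem_sigma, Finset.mem_erase] at h ⊢
    exact ⟨h.2.2, h.2.1.symm, h.1⟩
  · rintro ⟨i, j⟩ h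
    rfl

lemma kd_add (g : Fin m → R) (x y : Finset (Fin m) → M) : kd g (x + y) = kd g x + kd g y := by
  funext t
  simp [kd, Finset.sum_add_distrib]

lemma kd_sub (g : Fin m → R) (x y : Finset (Fin m) → M) : kd g (x - y) = kd g x - kd g y := by
  funext t
  simp [kd, smul_sub, Finset.sum_sub_distrib]

lemma kd_smul (g : Fin m → R) (r : R) (x : Finset (Fin m) → M) : kd g (r • x) = r • kd g x := by
  funext t
  simp only [kd, Pi.smul_apply, Finset.smul_sum]
  exact Finset.sum_congr rfl fun i _ => smul_comm _ _ _

lemma map_kd (φ : M →ₗ[R] N) (g : Fin m → R) (x : Finset (Fin m) → M) (t) :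
    φ (kd g x t) = kd g (fun s => φ (x s)) t := by
  simp [kd, map_sum]

/-- the product of the elements indexed by `s` -/
def fp (f : Fin m → R) (s : Finset (Fin m)) : R := ∏ i ∈ s, f i

lemma fp_erase (f : Fin m → R) {s : Finset (Fin m)} {i} (h : i ∈ s) :
    f i * fp f (s.erase i) = fp f s := Finset.mul_prod_erase s f h

lemma kd_raise (f : Fin m → R) (t k : ℕ) (x : Finset (Fin m) → M) (s : Finset (Fin m)) :
    kd (f ^ (t+k)) (fun u => fp f u ^ k • x u) s = fp f s ^ k • kd (f ^ t) x s := by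
  simp only [kd, Finset.smul_sum, smul_smul]
  refine Finset.sum_congr rfl fun i hi => ?_
  rw [← fp_erase f hi]
  congr 1
  simp only [Pi.pow_apply]
  ring

lemma kd_supp (g : Fin m → R) {x : Finset (Fin m) → M} {n : ℕ} (hx : ∀ s, s.card ≠ n → x s = 0)
    (s : Finset (Fin m)) (hs : s.card ≠ n + 1) : kd g x s = 0 := by
  refine Finset.sum_eq_zero fun i hi => ?_
  rw [hx, smul_zero]
  intro h
  apply hs
  rw [← h, Finset.card_erase_add_one hi]

lemma kd_congr (g : Fin m → R) {x y : Finset (Fin m) → M} {n : ℕ} (s : Finset (Fin m))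
    (hs : s.card = n + 1) (h : ∀ u, u.card = n → x u = y u) : kd g x s = kd g y s := by
  refine Finset.sum_congr rfl fun i hi => ?_
  rw [h]
  rw [Finset.card_erase_of_mem hi, hs]; rfl

end

section procx
variable {R : Type} [CommRing R] 

/-- Koszul chains -/
abbrev KQ (R : Type) [CommRing R] (m n : ℕ) : Type := {s : Finset (Fin m) // s.card = n} →₀ R

/-- basis elements, extended by zero -/
noncomputable def KS (R : Type) [CommRing R] {m : ℕ} (n : ℕ) (s : Finset (Fin m)) : KQ R m n :=
  if h : s.card = n then Finsupp.single ⟨s, h⟩ 1 else 0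

variable {M : Type} [AddCommGroup M] [Module R M]

/-- linear map defined by a function -/
noncomputable def KL {n : ℕ} (x : Finset (Fin m) → M) : KQ R m n →ₗ[R] M :=
  Finsupp.linearCombination R (fun s => x s.1)

lemma KL_KS {n : ℕ} (x : Finset (Fin m) → M) (s) (hs : s.card = n) : KL x (KS R n s) = x s := by
  simp [KL, KS, hs]

lemma KS_zero {n : ℕ} (s : Finset (Fin m)) (hs : s.card ≠ n) : KS R n s = 0 := by
  simp [KS, hs]

lemma KL_KS' {n : ℕ} (x : Finset (Fin m) → M) (hx : ∀ s, s.card ≠ n → x s = 0) (s) :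
    KL x (KS R n s) = x s := by
  by_cases h : s.card = n
  · exact KL_KS x s h
  · rw [KS_zero s h, hx s h, map_zero]

lemma KQ_ext {n : ℕ} {z z' : KQ R m n →ₗ[R] M} (h : ∀ s, s.card = n → z (KS R n s) = z' (KS R n s)) :
    z = z' := by
  apply Finsupp.lhom_ext'
  rintro ⟨s, hs⟩
  ext
  simpa [KS, hs] using h s hs

/-- the differential -/
noncomputable def KD (g : Fin m → R) (n : ℕ) : KQ R m (n+1) →ₗ[R] KQ R m n :=
  KL (kd g (KS R n))

lemma KD_KS (g : Fin m → R) (n : ℕ) (s) : KD g n (KS R (n+1) s) = kd g (KS R n) s :=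
  KL_KS' _ (fun s hs => kd_supp g (fun s hs => KS_zero s hs) s hs) s

/-- the transition maps -/
noncomputable def KP (f : Fin m → R) (k n : ℕ) : KQ R m n →ₗ[R] KQ R m n :=
  KL (fun s => fp f s ^ k • KS R n s)

lemma KP_KS (f : Fin m → R) (k n : ℕ) (s) : KP f k n (KS R n s) = fp f s ^ k • KS R n s :=
  KL_KS' _ (fun s hs => by rw [KS_zero s hs, smul_zero]) s

lemma KP_KD (f : Fin m → R) (t k n : ℕ) :
    KP f k n ∘ₗ KD (f ^ (t + k)) n = KD (f ^ t) n ∘ₗ KP f k (n+1) := by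
  apply KQ_ext
  intro s hs
  rw [LinearMap.comp_apply, LinearMap.comp_apply, KD_KS, KP_KS, map_smul, KD_KS, map_kd, ← kd_raise]
  simp only [KP_KS]

lemma KQ0 (x : KQ R m 0) : ∃ r : R, x = r • KS R 0 ∅ := by
  refine ⟨x ⟨∅, rfl⟩, ?_⟩
  ext ⟨s, hs⟩
  obtain rfl := Finset.card_eq_zero.1 hs
  simp [KS]

/-- the augmentation -/
noncomputable def KE (m : ℕ) (a : Ideal R) : KQ R m 0 →ₗ[R] R ⧸ a :=
  KL (fun _ => Ideal.Quotient.mk a 1)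

lemma KE_KS (a : Ideal R) (r : R) : KE m a (r • KS R 0 ∅) = Ideal.Quotient.mk a r := by
  rw [map_smul, KE, KL_KS _ _ Finset.card_empty]
  change Ideal.Quotient.mk a (r • 1) = _
  simp

lemma sg_singleton (i : Fin m) : sg R i {i} = 1 := by simp [sg, cmpSg]

lemma KE_exact (g : Fin m → R) (x : KQ R m 0) :
    KE m (Ideal.span (Set.range g)) x = 0 ↔ ∃ y, KD g 0 y = x := by
  have key : ∀ i : Fin m, KD g 0 (KS R 1 {i}) = g i • KS R 0 ∅ := by
    intro i
    rw [KD_KS]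
    simp [kd, sg_singleton]
  constructor
  · intro h
    obtain ⟨r, rfl⟩ := KQ0 x
    rw [KE_KS, Ideal.Quotient.eq_zero_iff_mem, Ideal.mem_span_range_iff_exists_fun] at h
    obtain ⟨c, rfl⟩ := h
    refine ⟨∑ i, c i • KS R 1 {i}, ?_⟩
    simp [key, Finset.sum_smul, smul_smul]
  · rintro ⟨y, rfl⟩
    have : KE m (Ideal.span (Set.range g)) ∘ₗ KD g 0 = 0 := by
      apply KQ_ext
      intro s hs
      obtain ⟨i, rfl⟩ := Finset.card_eq_one.1 hs
      rw [LinearMap.comp_apply, key, KE_KS, LinearMap.zero_apply, Ideal.Quotient.eq_zero_iff_mem]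
      exact Ideal.subset_span ⟨i, rfl⟩
    exact LinearMap.congr_fun this y

lemma KP_comp (f : Fin m → R) (k l n : ℕ) : KP f k n ∘ₗ KP f l n = KP f (l + k) n := by
  apply KQ_ext
  intro s _
  rw [LinearMap.comp_apply, KP_KS, map_smul, KP_KS, KP_KS, smul_smul, pow_add]

/-- The Koszul pro-complex. -/
noncomputable def kosPro (f : Fin m → R) : ProCx R (Ideal.span (Set.range f)) where
  Q _ n := KQ R m n
  d t n := KD (f ^ t) n
  proj t n := inferInstance
  dd t n x := by
    have : KD (f ^ t) n ∘ₗ KD (f ^ t) (n+1) = 0 := by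
      apply KQ_ext
      intro s _
      rw [LinearMap.comp_apply, KD_KS, map_kd]
      simp only [KD_KS]
      rw [show (fun s => kd (f ^ t) (KS R n) s) = kd (f ^ t) (KS R n) from rfl, kd_kd]
      rfl
    exact LinearMap.congr_fun this x
  a t := Ideal.span (Set.range (f ^ t))
  ε t := KE m _
  ε_surj t y := by
    obtain ⟨r, rfl⟩ := Ideal.Quotient.mk_surjective y
    exact ⟨_, KE_KS _ r⟩
  ε_exact t x := KE_exact _ x
  Adm t' t φ := ∃ k, t' = t + k ∧ ∀ n, φ n = KP f k n
  adm_comp := by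
    rintro t'' t' t φ ψ ⟨k, h1, h2⟩ ⟨l, h3, h4⟩
    refine ⟨k + l, by omega, fun n => ?_⟩
    change ψ n ∘ₗ φ n = _
    rw [h2, h4, KP_comp]
  adm_d := by
    rintro t' t φ ⟨k, rfl, h2⟩ n x
    rw [h2, h2]
    exact LinearMap.congr_fun (KP_KD f t k n) x
  adm_ε := by
    rintro t' t φ ⟨k, rfl, h2⟩ r x hx
    obtain ⟨r', rfl⟩ := KQ0 x
    rw [KE_KS] at hx
    rw [h2, map_smul, KP_KS, fp, Finset.prod_empty, one_pow, one_smul, KE_KS]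
    rw [Ideal.Quotient.eq] at hx ⊢
    refine Ideal.span_le.2 ?_ hx
    rintro _ ⟨i, rfl⟩
    rw [Pi.pow_apply, pow_add]
    exact Ideal.mul_mem_right _ _ (Ideal.subset_span ⟨i, rfl⟩)
  cof1 t := by
    apply Ideal.exists_pow_le_of_le_radical_of_fg
    · rw [Ideal.span_le]
      rintro _ ⟨i, rfl⟩
      exact ⟨t, Ideal.subset_span ⟨i, rfl⟩⟩
    · exact Submodule.fg_span (Set.finite_range f)
  cof2 t k := by
    refine ⟨t + k, fun n => KP f k n, ⟨k, rfl, fun n => rfl⟩, ?_⟩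
    rw [Ideal.span_le]
    rintro _ ⟨i, rfl⟩
    exact Ideal.pow_le_pow_right (Nat.le_add_left k t)
      (Ideal.pow_mem_pow (Ideal.subset_span (Set.mem_range_self i)) _)

lemma kosPro_stage (f : Fin m → R) {t k n : ℕ} {z : KQ R m (n+1) →ₗ[R] M} {v : Finset (Fin m) → M}
    (h : ∀ s, s.card = n + 1 → fp f s ^ k • z (KS R (n+1) s) = kd (f ^ (t + k)) v s) :
    ∃ t' φ, (kosPro f).Adm t' t φ ∧ ∃ v : (kosPro f).Q t' n →ₗ[R] M,
      z ∘ₗ φ (n+1) = v ∘ₗ (kosPro f).d t' n := by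
  refine ⟨t + k, fun n => KP f k n, ⟨k, rfl, fun n => rfl⟩, KL v, ?_⟩
  apply KQ_ext
  intro s hs
  change z (KP f k (n+1) _) = KL v (KD (f ^ (t+k)) n _)
  rw [KP_KS, map_smul, KD_KS, map_kd, h s hs]
  refine kd_congr _ s hs fun u hu => ?_
  rw [KL_KS _ _ hu]

lemma kosPro_cocyc (f : Fin m → R) {t n : ℕ} {z : KQ R m n →ₗ[R] M} :
   z ∘ₗ KD (f ^ t) n = KL (kd (f ^ t) fun s => z (KS R n s)) := by
  apply KQ_ext
  intro s hs
  rw [LinearMap.comp_apply, KD_KS, map_kd, KL_KS _ _ hs]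

lemma kosPro_inj (f : Fin m → R) (p : R) (n : ℕ)
    (H : ∀ t (x w : Finset (Fin m) → M), (∀ s, s.card ≠ n + 1 → x s = 0) →
      (∀ s, s.card ≠ n → w s = 0) → kd (f ^ t) x = 0 → p • x = kd (f ^ t) w →
      ∃ k v, ∀ s, s.card = n + 1 → fp f s ^ k • x s = kd (f ^ (t + k)) v s) :
    (kosPro f).Inj p n M := by
  intro t (z : KQ R m (n+1) →ₗ[R] M) (w : KQ R m n →ₗ[R] M)
    (hz : z ∘ₗ KD (f ^ t) (n+1) = 0) (hw : p • z = w ∘ₗ KD (f ^ t) n)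
  have hx0 : ∀ s, s.card ≠ n + 1 → z (KS R (n+1) s) = 0 := fun s hs => by
    rw [KS_zero s hs, map_zero]
  have hw0 : ∀ s, s.card ≠ n → w (KS R n s) = 0 := fun s hs => by
    rw [KS_zero s hs, map_zero]
  obtain ⟨k, v, h⟩ := H t (fun s => z (KS R (n+1) s)) (fun s => w (KS R n s)) hx0 hw0 (by
      funext s
      rw [← map_kd, ← KD_KS]
      exact LinearMap.congr_fun hz _) (by
      funext s
      rw [← map_kd, ← KD_KS]
      exact LinearMap.congr_fun hw _)
  exact kosPro_stage f h

lemma kosPro_van_of (f : Fin m → R) (n : ℕ)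
    (H : ∀ t (x : Finset (Fin m) → M), (∀ s, s.card ≠ n + 1 → x s = 0) →
      kd (f ^ t) x = 0 →
      ∃ k v, ∀ s, s.card = n + 1 → fp f s ^ k • x s = kd (f ^ (t + k)) v s) :
    (kosPro f).Van n M := by
  intro t (z : KQ R m (n+1) →ₗ[R] M) (hz : z ∘ₗ KD (f ^ t) (n+1) = 0)
  have hx0 : ∀ s, s.card ≠ n + 1 → z (KS R (n+1) s) = 0 := fun s hs => by
    rw [KS_zero s hs, map_zero]
  obtain ⟨k, v, h⟩ := H t (fun s => z (KS R (n+1) s)) hx0 (by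
      funext s
      rw [← map_kd, ← KD_KS]
      exact LinearMap.congr_fun hz _)
  exact kosPro_stage f h

/-- Extension property of injective modules. -/
lemma inj_ext [IsNoetherianRing R] (hM : Module.Injective R M) (g : R) (x : M) (t : ℕ) :
    ∃ k y, g ^ (t + k) • y = g ^ k • x ∧ ∀ r : R, r • x = 0 → r • y = 0 := by
  let T : ℕ → (R →ₗ[R] M) := fun k => LinearMap.toSpanSingleton R M (g ^ k • x)
  have hT : ∀ k r, T k r = (r * g ^ k) • x := fun k r => by
    simp [T, smul_smul]
  have hmono : Monotone fun k => LinearMap.ker (T k) := by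
    apply monotone_nat_of_le_succ
    intro k r hr
    rw [LinearMap.mem_ker, hT] at hr ⊢
    rw [pow_succ', mul_left_comm, mul_smul, hr, smul_zero]
  obtain ⟨k, hk⟩ := monotone_stabilizes_iff_noetherian.2 ‹IsNoetherianRing R› ⟨_, hmono⟩
  have hk' : LinearMap.ker (T (t + k)) = LinearMap.ker (T k) := (hk (t+k) (by omega)).symm
  let b := LinearMap.ker (T 0)
  let i0 : R →ₗ[R] R ⧸ b := b.mkQ ∘ₗ LinearMap.toSpanSingleton R R (g ^ (t + k))
  have hi0 : LinearMap.ker i0 = LinearMap.ker (T (t+k)) := by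
    ext r
    simp only [i0, LinearMap.mem_ker, LinearMap.comp_apply, Submodule.mkQ_apply,
      Submodule.Quotient.mk_eq_zero, b, hT]
    simp
  obtain ⟨h, hh⟩ := hM.out ((LinearMap.ker i0).liftQ i0 le_rfl)
    (by rw [← LinearMap.ker_eq_bot, Submodule.ker_liftQ_eq_bot' _ _ rfl])
    ((LinearMap.ker i0).liftQ (T k) (by rw [hi0, hk']))
  refine ⟨k, h (b.mkQ 1), ?_, ?_⟩
  · have := hh (Submodule.Quotient.mk 1)
    rw [Submodule.liftQ_apply, Submodule.liftQ_apply, hT, one_mul] at this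
    rw [← this, ← map_smul, ← map_smul]
    congr 1
    simp only [i0, LinearMap.comp_apply, LinearMap.toSpanSingleton_apply, one_mul, smul_eq_mul, mul_one]
  · intro r hr
    rw [← map_smul, ← map_smul, smul_eq_mul, mul_one]
    have : b.mkQ r = 0 := by
      rw [Submodule.mkQ_apply, Submodule.Quotient.mk_eq_zero, LinearMap.mem_ker, hT]
      simpa using hr
    rw [this, map_zero]

end procx
end PNLC
end

section
namespace PNLC
variable {R : Type} [CommRing R] {m : ℕ} {M : Type} [AddCommGroup M] [Module R M]

lemma pow_smul_mono {g : R} {x : M} {a b : ℕ} (h : a ≤ b) (hx : g ^ a • x = 0) : g ^ b • x = 0 := by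
  rw [← Nat.sub_add_cancel h, pow_add, mul_smul, hx, smul_zero]

lemma kos_van_aux [IsNoetherianRing R] (hM : Module.Injective R M) (f : Fin m → R) (n : ℕ)
    (B : Finset (Fin m)) : ∀ (A : Finset (Fin m)), A = Bᶜ → 
      ∀ t (x : Finset (Fin m) → M), (∀ s, s.card ≠ n + 1 → x s = 0) →
      kd (f ^ t) x = 0 → (∀ s, ∀ a ∈ A, a ∈ s → x s = 0) →
      (∃ N, ∀ s, ∀ a ∈ A, f a ^ N • x s = 0) →
      ∃ k v, ∀ s, s.card = n + 1 → fp f s ^ k • x s = kd (f ^ (t + k)) v s := by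
  induction B using Finset.induction_on with
  | empty =>
    rintro A rfl t x hx0 hx hA -
    refine ⟨0, 0, fun s hs => ?_⟩
    have : s.Nonempty := Finset.card_pos.1 (by omega)
    obtain ⟨a, ha⟩ := this
    rw [hA s a (by simp) ha]
    simp [kd]
  | insert i B hi ih =>
    rintro A rfl t x hx0 hx hA ⟨N, hN⟩
    have hext := fun s => inj_ext hM (f i) (x s) t
    choose k0 y hy1 hy2 using hext
    let k := Finset.univ.sup k0
    have hk : ∀ s, k0 s ≤ k := fun s => Finset.le_sup (Finset.mem_univ s)
    have hy : ∀ s, f i ^ (t + k) • y s = f i ^ k • x s := by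
      intro s
      have : k = k0 s + (k - k0 s) := by have := hk s; omega
      rw [this, ← add_assoc, pow_add, mul_comm, mul_smul, hy1, smul_smul, ← pow_add, add_comm (k - k0 s)]
    let z : Finset (Fin m) → M := fun u => if i ∈ u then 0 else
      (sg R i (insert i u) * fp f u ^ k) • y (insert i u)
    have hz0 : ∀ u, u.card ≠ n → z u = 0 := by
      intro u hu
      by_cases hiu : i ∈ u
      · simp [z, hiu]
      · have h0 : x (insert i u) = 0 := hx0 _ (by rw [Finset.card_insert_of_notMem hiu]; omega)
        have : y (insert i u) = 0 := by
          have := hy2 (insert i u) 1 (by rw [h0, smul_zero])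
          rwa [one_smul] at this
        simp [z, this]
    have hzA : ∀ u, ∀ a ∈ (insert i B)ᶜ, a ∈ u → z u = 0 := by
      intro u a ha hau
      by_cases hiu : i ∈ u
      · simp [z, hiu]
      · have h0 : x (insert i u) = 0 := hA _ a ha (Finset.mem_insert_of_mem hau)
        have : y (insert i u) = 0 := by
          have := hy2 (insert i u) 1 (by rw [h0, smul_zero])
          rwa [one_smul] at this
        simp [z, this]
    have hzN : ∀ u, ∀ a ∈ (insert i B)ᶜ, f a ^ N • z u = 0 := by
      intro u a ha
      by_cases hiu : i ∈ u
      · simp [z, hiu]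
      · simp only [z, hiu, if_false]
        rw [smul_comm, hy2 _ _ (hN _ a ha), smul_zero]
    let x' : Finset (Fin m) → M := (fun s => fp f s ^ k • x s) - kd (f ^ (t + k)) z
    have hx'0 : ∀ s, s.card ≠ n + 1 → x' s = 0 := by
      intro s hs
      simp only [x', Pi.sub_apply, hx0 s hs, smul_zero, kd_supp _ hz0 s hs, sub_zero]
    have hx' : kd (f ^ (t + k)) x' = 0 := by
      rw [kd_sub, kd_kd, sub_zero]
      funext s
      rw [kd_raise, hx]
      simp
    have hx'i : ∀ s, i ∈ s → x' s = 0 := by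
      intro s his
      have : kd (f ^ (t + k)) z s = fp f s ^ k • x s := by
        unfold kd
        rw [Finset.sum_eq_single_of_mem i his]
        · simp only [z, Finset.notMem_erase, if_false, Finset.insert_erase his, smul_smul,
            Pi.pow_apply]
          rw [← fp_erase f his, mul_pow, mul_comm (f i ^ k), mul_smul (_ ^ k), ← hy, smul_smul]
          congr 1
          linear_combination (f i ^ (t+k) * fp f (s.erase i) ^ k) * sg_mul_self (R := R) i s
        · intro j hj hji
          have : z (s.erase j) = 0 := by
            simp [z, Ne.symm hji, his]
          rw [this, smul_zero]
      simp only [x', Pi.sub_apply, this, sub_self]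
    have hx'N : ∀ s, ∀ a ∈ (insert i B)ᶜ, f a ^ N • x' s = 0 := by
      intro s a ha
      simp only [x', Pi.sub_apply, smul_sub, kd, Finset.smul_sum]
      rw [smul_comm, hN s a ha, smul_zero, zero_sub, neg_eq_zero]
      refine Finset.sum_eq_zero fun j _ => ?_
      rw [smul_comm, hzN _ a ha, smul_zero]
    have hx'iN : ∀ s, f i ^ (t + k) • x' s = 0 := by
      intro s
      by_cases his : i ∈ s
      · rw [hx'i s his, smul_zero]
      · have h1 := congrFun hx' (insert i s)
        unfold kd at h1
        rw [Finset.sum_eq_single_of_mem i (Finset.mem_insert_self _ _)] at h1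
        · rw [Finset.erase_insert his, Pi.pow_apply, mul_smul] at h1
          have h2 := congrArg (fun q => sg R i (insert i s) • q) h1
          simpa [smul_smul, ← mul_assoc, sg_mul_self] using h2
        · intro j hj hji
          rw [hx'i _ (by simp [Ne.symm hji]), smul_zero]
    let x'' : Finset (Fin m) → M := fun s => fp f s ^ N • x' s
    obtain ⟨k2, v, hv⟩ := ih _ rfl (t + k + N) x'' (by
      intro s hs
      simp only [x'', hx'0 s hs, smul_zero]) (by
      funext s
      simp only [x'']
      rw [kd_raise, hx']
      simp) (by
      intro s a ha has
      by_cases hai : a = i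
      · subst hai
        simp only [x'', hx'i s has, smul_zero]
      · simp only [x'']
        rw [← fp_erase f has, mul_pow, mul_comm, mul_smul, hx'N s a (by simpa [hai] using ha), smul_zero])
      ⟨max N (t + k), by
        intro s a ha
        by_cases hai : a = i
        · subst hai
          simp only [x'']
          rw [smul_comm, pow_smul_mono (le_max_right _ _) (hx'iN s), smul_zero]
        · simp only [x'']
          rw [smul_comm, pow_smul_mono (le_max_left _ _) (hx'N s a (by simpa [hai] using ha)), smul_zero]⟩
    refine ⟨k + (N + k2), v + fun u => fp f u ^ (N + k2) • z u, fun s hs => ?_⟩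
    rw [kd_add, Pi.add_apply, ← add_assoc t, kd_raise, ← add_assoc (t+k), ← hv s hs]
    simp only [x'', x', Pi.sub_apply, smul_sub, smul_smul, ← pow_add]
    rw [show k2 + (N + k) = k + (N + k2) by omega, add_comm N k2]
    abel

lemma kosPro_van [IsNoetherianRing R] (hM : Module.Injective R M) (f : Fin m → R) (n : ℕ) :
    (kosPro f).Van n M := by
  apply kosPro_van_of
  intro t x h0 hx
  refine kos_van_aux hM f n Finset.univ ∅ (by simp) t x h0 hx (by simp) ⟨0, by simp⟩

end PNLC
end

section
namespace PNLC
section loc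
variable {B : Type} [CommRing B] {m : ℕ} (f : Fin m → B)

/-- Localization at the product of the elements indexed by `s`. -/
abbrev LL (f : Fin m → B) (s : Finset (Fin m)) : Type := Localization.Away (fp f s)

/-- fraction `a / f_s ^ t` -/
noncomputable def fr (s : Finset (Fin m)) (t : ℕ) (a : B) : LL f s :=
  algebraMap B (LL f s) a * IsLocalization.Away.invSelf (fp f s) ^ t

lemma fp_inv (s : Finset (Fin m)) : algebraMap B (LL f s) (fp f s) *
    IsLocalization.Away.invSelf (S := LL f s) (fp f s) = 1 := IsLocalization.Away.mul_invSelf _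

lemma fp_unit (s : Finset (Fin m)) : IsUnit (algebraMap B (LL f s) (fp f s)) :=
  IsLocalization.Away.algebraMap_isUnit _

lemma fr_spec (s : Finset (Fin m)) (t : ℕ) (a : B) :
    fr f s t a * algebraMap B (LL f s) (fp f s) ^ t = algebraMap B _ a := by
  rw [fr, mul_assoc, ← mul_pow, mul_comm (IsLocalization.Away.invSelf _), fp_inv, one_pow, mul_one]

lemma fr_unique (s : Finset (Fin m)) (t : ℕ) (a : B) (y : LL f s)
    (h : y * algebraMap B (LL f s) (fp f s) ^ t = algebraMap B _ a) : y = fr f s t a := by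
  have := (fp_unit f s).pow t
  apply this.mul_right_cancel
  rw [h, fr_spec]

lemma fr_zero (s : Finset (Fin m)) (a : B) : fr f s 0 a = algebraMap B _ a := by
  simp [fr]

lemma fr_raise (s : Finset (Fin m)) (t k : ℕ) (a : B) :
    fr f s (t + k) (fp f s ^ k * a) = fr f s t a := by
  symm
  apply fr_unique
  rw [pow_add, ← mul_assoc, fr_spec, map_mul, map_pow, mul_comm]

lemma fr_surj (s : Finset (Fin m)) (y : LL f s) : ∃ t a, y = fr f s t a := by
  obtain ⟨n, a, h⟩ := IsLocalization.Away.surj (fp f s) y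
  exact ⟨n, a, fr_unique f s n a y h⟩

lemma fr_eq_zero (s : Finset (Fin m)) (t : ℕ) (a : B) (h : fr f s t a = 0) :
    ∃ k, fp f s ^ k * a = 0 := by
  have h1 := fr_spec f s t a
  rw [h, zero_mul, ← map_zero (algebraMap B _)] at h1
  obtain ⟨k, hk⟩ := IsLocalization.Away.exists_of_eq (fp f s) h1.symm
  exact ⟨k, by rw [hk, mul_zero]⟩

lemma fr_add (s : Finset (Fin m)) (t : ℕ) (a b : B) : fr f s t (a + b) = fr f s t a + fr f s t b := by
  simp [fr, add_mul]

lemma fr_sub (s : Finset (Fin m)) (t : ℕ) (a b : B) : fr f s t (a - b) = fr f s t a - fr f s t b := by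
  simp [fr, sub_mul]

lemma fr_sum (s : Finset (Fin m)) (t : ℕ) {ι : Type*} (A : Finset ι) (a : ι → B) :
    fr f s t (∑ i ∈ A, a i) = ∑ i ∈ A, fr f s t (a i) := by
  simp [fr, Finset.sum_mul]

lemma fr_mul (s : Finset (Fin m)) (t : ℕ) (a b : B) :
    fr f s t (a * b) = algebraMap B _ a * fr f s t b := by
  simp [fr, mul_assoc]

lemma fr_pow (s : Finset (Fin m)) (t q : ℕ) (a : B) : fr f s t a ^ q = fr f s (t * q) (a ^ q) := by
  simp [fr, mul_pow, pow_mul]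

/-- restriction maps -/
noncomputable def res {u s : Finset (Fin m)} (h : u ⊆ s) : LL f u →+* LL f s :=
  IsLocalization.Away.lift (fp f u) (g := algebraMap B (LL f s))
    (IsLocalization.Away.isUnit_of_dvd (fp f s) (Finset.prod_dvd_prod_of_subset _ _ _ h))

lemma res_algebraMap {u s : Finset (Fin m)} (h : u ⊆ s) (a : B) :
    res f h (algebraMap B _ a) = algebraMap B _ a := IsLocalization.Away.lift_eq _ _ _

lemma LL_hom_ext {s : Finset (Fin m)} {T : Type*} [CommRing T] {α β : LL f s →+* T}
    (h : ∀ a, α (algebraMap B _ a) = β (algebraMap B _ a)) : α = β :=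
  IsLocalization.ringHom_ext (Submonoid.powers (fp f s)) (RingHom.ext h)

lemma res_fr_erase {s : Finset (Fin m)} {i : Fin m} (hi : i ∈ s) (t : ℕ) (a : B) :
    res f (Finset.erase_subset i s) (fr f (s.erase i) t a) = fr f s t (f i ^ t * a) := by
  apply fr_unique
  have h1 := congrArg (res f (Finset.erase_subset i s)) (fr_spec f (s.erase i) t a)
  rw [map_mul, map_pow, res_algebraMap, res_algebraMap] at h1
  have h2 : algebraMap B (LL f s) (fp f s) =
      algebraMap B (LL f s) (f i) * algebraMap B (LL f s) (fp f (s.erase i)) := by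
    rw [← map_mul]
    exact congrArg _ (fp_erase f hi).symm
  rw [h2, map_mul, ← h1, mul_pow, map_pow]
  ring

/-- The total Cech differential. -/
noncomputable def cd (X : ∀ s, LL f s) (s : Finset (Fin m)) : LL f s :=
  ∑ i ∈ s, sg (LL f s) i s * res f (Finset.erase_subset i s) (X (s.erase i))

/-- a level `t` cochain as a Cech cochain -/
noncomputable def io (t : ℕ) (x : Finset (Fin m) → B) (s : Finset (Fin m)) : LL f s :=
  fr f s t (x s)

lemma cd_io (t : ℕ) (x : Finset (Fin m) → B) : cd f (io f t x) = io f t (kd (f ^ t) x) := by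
  funext s
  simp only [cd, io, kd, fr_sum]
  refine Finset.sum_congr rfl fun i hi => ?_
  rw [res_fr_erase f hi, smul_eq_mul, mul_assoc, fr_mul f s t (sg B i s), map_sg]
  rfl

lemma io_raise (t k : ℕ) (x : Finset (Fin m) → B) :
    io f (t + k) (fun s => fp f s ^ k • x s) = io f t x := by
  funext s
  exact fr_raise f s t k (x s)

lemma io_surj (X : ∀ s, LL f s) (t : ℕ) : ∃ k x, X = io f (t + k) x := by
  choose e a h using fun s => fr_surj f s (X s)
  refine ⟨Finset.univ.sup e, fun s => fp f s ^ (t + Finset.univ.sup e - e s) * a s, ?_⟩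
  funext s
  have hs : e s ≤ Finset.univ.sup e := Finset.le_sup (Finset.mem_univ s)
  rw [h s, io, ← fr_raise f s (e s) (t + Finset.univ.sup e - e s)]
  congr 1
  omega

lemma io_eq_zero (t : ℕ) (x : Finset (Fin m) → B) (h : ∀ s, io f t x s = 0) :
    ∃ k, ∀ s, fp f s ^ k • x s = 0 := by
  choose e he using fun s => fr_eq_zero f s t (x s) (h s)
  refine ⟨Finset.univ.sup e, fun s => ?_⟩
  have hs : e s ≤ Finset.univ.sup e := Finset.le_sup (Finset.mem_univ s)
  rw [← Nat.sub_add_cancel hs, pow_add, smul_eq_mul, mul_assoc, he, mul_zero]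

lemma cd_add (X Y : ∀ s, LL f s) : cd f (X + Y) = cd f X + cd f Y := by
  funext s
  simp [cd, mul_add, Finset.sum_add_distrib]

lemma cd_sub (X Y : ∀ s, LL f s) : cd f (X - Y) = cd f X - cd f Y := by
  funext s
  simp [cd, mul_sub, Finset.sum_sub_distrib]

lemma cd_mul (b : B) (X : ∀ s, LL f s) (s) :
    cd f (fun s => algebraMap B _ b * X s) s = algebraMap B _ b * cd f X s := by
  simp only [cd, Finset.mul_sum, map_mul, res_algebraMap]
  exact Finset.sum_congr rfl fun i _ => by ring

end loc

section red
variable {B B' : Type} [CommRing B] [CommRing B'] {m : ℕ} (φ : B →+* B') (f : Fin m → B)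

lemma map_fp (s : Finset (Fin m)) : φ (fp f s) = fp (fun i => φ (f i)) s := by
  simp [fp]

/-- induced map on localizations -/
noncomputable def red (s : Finset (Fin m)) : LL f s →+* LL (fun i => φ (f i)) s :=
  IsLocalization.Away.lift (fp f s) (g := (algebraMap B' (LL (fun i => φ (f i)) s)).comp φ)
    (by rw [RingHom.comp_apply, map_fp]; exact fp_unit _ _)

lemma red_algebraMap (s : Finset (Fin m)) (a : B) : red φ f s (algebraMap B _ a) =
    algebraMap B' _ (φ a) := IsLocalization.Away.lift_eq _ _ _

lemma red_fr (s : Finset (Fin m)) (t : ℕ) (a : B) :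
    red φ f s (fr f s t a) = fr (fun i => φ (f i)) s t (φ a) := by
  apply fr_unique
  have h1 := congrArg (red φ f s) (fr_spec f s t a)
  rwa [map_mul, map_pow, red_algebraMap, red_algebraMap, map_fp] at h1

lemma red_res {u s : Finset (Fin m)} (h : u ⊆ s) (y : LL f u) :
    red φ f s (res f h y) = res _ h (red φ f u y) := by
  have : (red φ f s).comp (res f h) = (res _ h).comp (red φ f u) := by
    apply LL_hom_ext
    intro a
    simp [res_algebraMap, red_algebraMap]
  exact RingHom.congr_fun this y

lemma red_cd (X : ∀ s, LL f s) (s) :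
    red φ f s (cd f X s) = cd (fun i => φ (f i)) (fun s => red φ f s (X s)) s := by
  simp [cd, map_sum, map_sg, red_res]

lemma red_io (t : ℕ) (x : Finset (Fin m) → B) (s) :
    red φ f s (io f t x s) = io (fun i => φ (f i)) t (fun s => φ (x s)) s := red_fr φ f s t _

/-- kernel of the reduction -/
lemma red_ker (p : B) (hker : ∀ a, φ a = 0 → p ∣ a) (s) (y : LL f s) (h : red φ f s y = 0) :
    ∃ z, y = algebraMap B _ p * z := by
  obtain ⟨t, a, rfl⟩ := fr_surj f s y
  rw [red_fr] at h
  obtain ⟨k, hk⟩ := fr_eq_zero _ _ _ _ h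
  rw [← map_fp, ← map_pow, ← map_mul] at hk
  obtain ⟨b, hb⟩ := hker _ hk
  refine ⟨fr f s (t + k) b, ?_⟩
  rw [← fr_raise f s t k a, hb, fr_mul]

lemma LL_nzd (p : B) (hp : ∀ a, p * a = 0 → a = 0) (s) (y : LL f s)
    (h : algebraMap B _ p * y = 0) : y = 0 := by
  obtain ⟨t, a, rfl⟩ := fr_surj f s y
  rw [← fr_mul] at h
  obtain ⟨k, hk⟩ := fr_eq_zero _ _ _ _ h
  rw [← fr_raise f s t k a, hp (fp f s ^ k * a) (by rw [← hk]; ring)]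
  simp [fr]

end red
end PNLC
end

section
namespace PNLC

section binom
lemma choose_zero (p : ℕ) [Fact p.Prime] (k a b : ℕ) (ha : a < p ^ k) (hb : b < p ^ k) (hab : a ≠ b) :
    (((p ^ k - 1 - b + a).choose (p ^ k - 1) : ℕ) : ZMod p) = 0 := by
  rcases lt_or_gt_of_ne hab with h | h
  · rw [Nat.choose_eq_zero_of_lt (by omega)]; simp
  · have h1 : p ^ k - 1 - b + a = p ^ k + (a - b - 1) := by omega
    rw [h1, ← Polynomial.coeff_X_add_one_pow, pow_add, add_pow_char_pow, one_pow, add_mul, one_mul,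
      Polynomial.coeff_add, Polynomial.coeff_X_pow_mul', if_neg (by omega),
      Polynomial.coeff_X_add_one_pow, Nat.choose_eq_zero_of_lt (by omega)]
    simp
end binom

section ps
variable {L : Type} [CommRing L] {d : ℕ}

/-- constant exponent vector -/
noncomputable def cst (d q : ℕ) : Fin d →₀ ℕ := Finsupp.equivFunOnFinite.symm fun _ => q

@[simp] lemma cst_apply (q : ℕ) (i : Fin d) : cst d q i = q := rfl

lemma prod_monomial' (x : Fin d → ℕ) (c : Fin d → L) (A : Finset (Fin d)) :
    ∏ i ∈ A, MvPowerSeries.monomial (Finsupp.single i (x i)) (c i) =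
      MvPowerSeries.monomial (∑ i ∈ A, Finsupp.single i (x i)) (∏ i ∈ A, c i) := by
  induction A using Finset.induction_on with
  | empty => simp
  | insert i A hi ih => simp [Finset.prod_insert hi, Finset.sum_insert hi, ih, MvPowerSeries.monomial_mul_monomial]

lemma coeff_prod_add (x : Fin d → L) (E : Fin d → ℕ) (e : Fin d →₀ ℕ) :
    MvPowerSeries.coeff e (∏ i, (MvPowerSeries.X i + MvPowerSeries.C (x i)) ^ E i) =
      ∏ i, x i ^ (E i - e i) * ((E i).choose (e i) : L) := by
  have h1 : ∀ i, (MvPowerSeries.X i + MvPowerSeries.C (x i)) ^ E i =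
      ∑ j ∈ Finset.range (E i + 1), MvPowerSeries.monomial (Finsupp.single i j)
        (x i ^ (E i - j) * ((E i).choose j : L)) := by
    intro i
    rw [add_pow]
    refine Finset.sum_congr rfl fun j _ => ?_
    rw [MvPowerSeries.X_pow_eq, ← map_pow, mul_assoc, ← map_natCast (MvPowerSeries.C),
      ← map_mul, ← MvPowerSeries.monomial_zero_eq_C_apply, MvPowerSeries.monomial_mul_monomial]
    simp
  simp_rw [h1]
  rw [Finset.prod_univ_sum, map_sum]
  simp_rw [prod_monomial']
  have h2 : ∀ y : Fin d → ℕ, ∑ i, Finsupp.single i (y i) = Finsupp.equivFunOnFinite.symm y := by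
    intro y
    ext j
    simp [Finsupp.finsetSum_apply, Finsupp.single_apply]
  simp_rw [h2, MvPowerSeries.coeff_monomial]
  by_cases he : ∀ i, e i ≤ E i
  · rw [Finset.sum_eq_single (fun i => e i)]
    · rw [if_pos]
      ext i; rfl
    · intro y _ hy
      rw [if_neg]
      rintro rfl
      exact hy rfl
    · intro h
      exact absurd (Fintype.mem_piFinset.2 fun i => Finset.mem_range.2 (Nat.lt_succ_of_le (he i))) h
  · push Not at he
    obtain ⟨i, hi⟩ := he
    rw [Finset.prod_eq_zero (Finset.mem_univ i), Finset.sum_eq_zero]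
    · intro y hy
      rw [if_neg]
      rintro rfl
      have := Finset.mem_range.1 (Fintype.mem_piFinset.1 hy i)
      simp at hi
      omega
    · rw [Nat.choose_eq_zero_of_lt hi]; simp

lemma coeff_mul_pow (p : ℕ) [ExpChar L p] (hp : p ≠ 0) (k : ℕ) (φ ψ : MvPowerSeries (Fin d) L) :
    MvPowerSeries.coeff (cst d (p ^ k - 1)) (ψ * φ ^ p ^ k) =
      MvPowerSeries.coeff (cst d (p ^ k - 1)) ψ * MvPowerSeries.constantCoeff φ ^ p ^ k := by
  classical
  have hq : 0 < p ^ k := by positivity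
  rw [MvPowerSeries.coeff_mul, Finset.sum_eq_single (cst d (p ^ k - 1), 0)]
  · simp
  · rintro ⟨u, v⟩ huv hne
    rw [Finset.HasAntidiagonal.mem_antidiagonal] at huv
    simp only at huv ⊢
    rw [← MvPowerSeries.map_iterateFrobenius_expand p hp, MvPowerSeries.coeff_map]
    have : ∃ i, v i ≠ 0 := by
      by_contra! h
      have hv : v = 0 := Finsupp.ext h
      subst hv
      rw [add_zero] at huv
      subst huv
      exact hne rfl
    obtain ⟨i, hi⟩ := this
    rw [MvPowerSeries.coeff_expand_of_not_dvd (i := i), map_zero, mul_zero]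
    intro hd
    have h1 := Nat.le_of_dvd (Nat.pos_of_ne_zero hi) hd
    have h2 := DFunLike.congr_fun huv i
    simp at h2
    omega
  · intro h
    simp at h

lemma coeff_key (p : ℕ) [Fact p.Prime] [CharP L p] (k : ℕ) (x : Fin d → L) (a b : Fin d → ℕ)
    (ha : ∀ i, a i < p ^ k) (hb : ∀ i, b i < p ^ k) (φ : MvPowerSeries (Fin d) L) :
    MvPowerSeries.coeff (cst d (p ^ k - 1)) ((∏ i, (MvPowerSeries.X i + MvPowerSeries.C (x i)) ^
      (p ^ k - 1 - b i + a i)) * φ ^ p ^ k) =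
      if a = b then MvPowerSeries.constantCoeff φ ^ p ^ k else 0 := by
  have := ExpChar.prime (R := L) (Fact.out : p.Prime)
  rw [coeff_mul_pow p (Fact.out : p.Prime).ne_zero, coeff_prod_add]
  split_ifs with h
  · subst h
    rw [Finset.prod_eq_one, one_mul]
    intro i _
    have := ha i
    rw [cst_apply, Nat.sub_add_cancel (by omega)]
    simp
  · obtain ⟨i, hi⟩ := Function.ne_iff.1 h
    rw [Finset.prod_eq_zero (Finset.mem_univ i), zero_mul]
    have := congrArg (ZMod.castHom (dvd_refl p) L) (choose_zero p k (a i) (b i) (ha i) (hb i) hi)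
    rw [map_natCast, map_zero] at this
    rw [cst_apply, this, mul_zero]
end ps

section taylor
variable {A : Type} [CommRing A] {d m : ℕ} (f : Fin m → MvPolynomial (Fin d) A)

/-- Taylor expansion on polynomials -/
noncomputable def tb (s : Finset (Fin m)) :
    MvPolynomial (Fin d) A →+* MvPowerSeries (Fin d) (LL f s) :=
  MvPolynomial.eval₂Hom (MvPowerSeries.C.comp
    ((algebraMap (MvPolynomial (Fin d) A) (LL f s)).comp MvPolynomial.C))
    (fun i => MvPowerSeries.X i + MvPowerSeries.C (algebraMap (MvPolynomial (Fin d) A) (LL f s)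
      (MvPolynomial.X i)))

lemma tb_C (s : Finset (Fin m)) (a : A) : tb f s (MvPolynomial.C a) =
    MvPowerSeries.C (algebraMap (MvPolynomial (Fin d) A) (LL f s) (MvPolynomial.C a)) := by
  simp [tb]

lemma tb_X (s : Finset (Fin m)) (i : Fin d) : tb f s (MvPolynomial.X i) =
    MvPowerSeries.X i + MvPowerSeries.C (algebraMap (MvPolynomial (Fin d) A) (LL f s)
      (MvPolynomial.X i)) := by
  simp [tb]

lemma tb_const (s : Finset (Fin m)) (g : MvPolynomial (Fin d) A) :
    MvPowerSeries.constantCoeff (tb f s g) = algebraMap _ (LL f s) g := by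
  have : (MvPowerSeries.constantCoeff).comp (tb f s) = algebraMap _ (LL f s) := by
    apply MvPolynomial.ringHom_ext
    · intro a; simp [tb_C]
    · intro i; simp [tb_X]
  exact RingHom.congr_fun this g

/-- Taylor expansion -/
noncomputable def tay (s : Finset (Fin m)) : LL f s →+* MvPowerSeries (Fin d) (LL f s) :=
  IsLocalization.Away.lift (fp f s) (g := tb f s)
    (by rw [MvPowerSeries.isUnit_iff_constantCoeff, tb_const]; exact fp_unit _ _)

lemma tay_algebraMap (s : Finset (Fin m)) (g : MvPolynomial (Fin d) A) :
    tay f s (algebraMap _ _ g) = tb f s g := IsLocalization.Away.lift_eq _ _ _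

lemma tay_const (s : Finset (Fin m)) (y : LL f s) :
    MvPowerSeries.constantCoeff (tay f s y) = y := by
  have : (MvPowerSeries.constantCoeff).comp (tay f s) = RingHom.id _ := by
    apply LL_hom_ext
    intro a
    simp [tay_algebraMap, tb_const]
  exact RingHom.congr_fun this y

lemma tay_res {u s : Finset (Fin m)} (h : u ⊆ s) (y : LL f u) :
    tay f s (res f h y) = MvPowerSeries.map (res f h) (tay f u y) := by
  have : (tay f s).comp (res f h) = (MvPowerSeries.map (res f h)).comp (tay f u) := by
    apply LL_hom_ext
    intro g
    simp only [RingHom.comp_apply, res_algebraMap, tay_algebraMap]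
    have : tb f s = (MvPowerSeries.map (res f h)).comp (tb f u) := by
      apply MvPolynomial.ringHom_ext
      · intro a; simp [tb_C, res_algebraMap]
      · intro i; simp [tb_X, res_algebraMap]
    exact RingHom.congr_fun this g
  exact RingHom.congr_fun this y

/-- the Hasse derivative operator with all exponents `e` -/
noncomputable def th (e : ℕ) (s : Finset (Fin m)) (y : LL f s) : LL f s :=
  MvPowerSeries.coeff (cst d e) (tay f s y)

lemma th_add (e s) (y z : LL f s) : th f e s (y + z) = th f e s y + th f e s z := by simp [th]

lemma th_sum (e s) {ι : Type*} (J : Finset ι) (y : ι → LL f s) :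
    th f e s (∑ i ∈ J, y i) = ∑ i ∈ J, th f e s (y i) := by simp [th]

lemma th_neg (e s) (y : LL f s) : th f e s (- y) = - th f e s y := by simp [th]

lemma th_zero (e s) : th f e s 0 = 0 := by simp [th]

lemma th_sg (e s) (i : Fin m) (t : Finset (Fin m)) (y : LL f s) :
    th f e s (sg (LL f s) i t * y) = sg (LL f s) i t * th f e s y := by
  rw [sg_eq]
  rcases neg_one_pow_eq_or (LL f s) ((t.filter (fun j => j < i)).card) with h | h <;> rw [h] <;>
    simp [th_neg]

lemma th_cd (e : ℕ) (X : ∀ s, LL f s) (s) :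
    cd f (fun s => th f e s (X s)) s = th f e s (cd f X s) := by
  simp only [cd, th_sum, th_sg]
  refine Finset.sum_congr rfl fun i _ => ?_
  rw [th, th, tay_res, MvPowerSeries.coeff_map]

end taylor

section taylorred
variable {A A' : Type} [CommRing A] [CommRing A'] (ψ : A →+* A') {d m : ℕ}
  (f : Fin m → MvPolynomial (Fin d) A)

lemma red_tay (s : Finset (Fin m)) (y : LL f s) :
    tay (fun i => MvPolynomial.map ψ (f i)) s (red (MvPolynomial.map ψ) f s y) =
      MvPowerSeries.map (red (MvPolynomial.map ψ) f s) (tay f s y) := by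
  have : (tay (fun i => MvPolynomial.map ψ (f i)) s).comp (red (MvPolynomial.map ψ) f s) =
      (MvPowerSeries.map (red (MvPolynomial.map ψ) f s)).comp (tay f s) := by
    apply LL_hom_ext
    intro g
    simp only [RingHom.comp_apply, red_algebraMap, tay_algebraMap]
    have : (tb (fun i => MvPolynomial.map ψ (f i)) s).comp (MvPolynomial.map ψ) =
        (MvPowerSeries.map (red (MvPolynomial.map ψ) f s)).comp (tb f s) := by
      apply MvPolynomial.ringHom_ext
      · intro a; simp [tb_C, red_algebraMap]
      · intro i; simp [tb_X, red_algebraMap]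
    exact RingHom.congr_fun this g
  exact RingHom.congr_fun this y

lemma red_th (e : ℕ) (s : Finset (Fin m)) (y : LL f s) :
    red (MvPolynomial.map ψ) f s (th f e s y) =
      th (fun i => MvPolynomial.map ψ (f i)) e s (red (MvPolynomial.map ψ) f s y) := by
  rw [th, th, red_tay, MvPowerSeries.coeff_map]
end taylorred

section taylorp
/-- monomial with exponent function `a` -/
noncomputable def mo (p : ℕ) {d : ℕ} (a : Fin d → ℕ) : MvPolynomial (Fin d) (ZMod p) :=
  ∏ i, MvPolynomial.X i ^ a i

variable {p : ℕ} [Fact p.Prime] {d m : ℕ} (f : Fin m → MvPolynomial (Fin d) (ZMod p))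

lemma th_key (k : ℕ) (s : Finset (Fin m)) (a b : Fin d → ℕ)
    (ha : ∀ i, a i < p ^ k) (hb : ∀ i, b i < p ^ k) (y : LL f s) :
    th f (p ^ k - 1) s (algebraMap _ _ (mo p (fun i => p ^ k - 1 - b i)) *
      (algebraMap _ _ (mo p a) * y ^ p ^ k)) = if a = b then y ^ p ^ k else 0 := by
  rcases subsingleton_or_nontrivial (LL f s) with h | h
  · exact Subsingleton.elim _ _
  haveI : CharP (LL f s) p := by
    haveI : Algebra (ZMod p) (LL f s) :=
      ((algebraMap (MvPolynomial (Fin d) (ZMod p)) (LL f s)).comp MvPolynomial.C).toAlgebra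
    exact charP_of_injective_algebraMap (algebraMap (ZMod p) (LL f s)).injective p
  rw [th, ← mul_assoc, ← map_mul, map_mul, map_pow, tay_algebraMap, mo, mo, ← Finset.prod_mul_distrib,
    map_prod]
  simp_rw [← pow_add, map_pow, tb_X]
  rw [coeff_key p k _ a b ha hb, tay_const]

end taylorp
end PNLC
end

section
namespace PNLC
section decomp
open MvPolynomial
variable {p : ℕ} [Fact p.Prime] {d m : ℕ}

/-- exponentwise division -/
noncomputable def dv {d : ℕ} (q : ℕ) (u : Fin d →₀ ℕ) : Fin d →₀ ℕ := u.mapRange (· / q) (Nat.zero_div q)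

@[simp] lemma dv_apply (q : ℕ) (u : Fin d →₀ ℕ) (i) : dv q u i = u i / q := by simp [dv]

/-- the components of a polynomial with respect to the basis of monomials over `q`-th powers -/
noncomputable def ca {p d : ℕ} (q : ℕ) (a : Fin d → ℕ) :
    MvPolynomial (Fin d) (ZMod p) →ₗ[ZMod p] MvPolynomial (Fin d) (ZMod p) :=
  (MvPolynomial.basisMonomials (Fin d) (ZMod p)).constr (ZMod p)
    (fun u => if a = (fun i => u i % q) then monomial (dv q u) 1 else 0)

lemma ca_monomial (q : ℕ) (a : Fin d → ℕ) (u : Fin d →₀ ℕ) (c : ZMod p) :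
    ca q a (monomial u c) = if a = (fun i => u i % q) then monomial (dv q u) c else 0 := by
  have h : monomial u c = c • (MvPolynomial.basisMonomials (Fin d) (ZMod p)) u := by
    simp [smul_monomial]
  rw [h, map_smul, ca, Module.Basis.constr_basis]
  split_ifs <;> simp [smul_monomial]

lemma mo_eq (a : Fin d → ℕ) : mo p a = monomial (Finsupp.equivFunOnFinite.symm a) 1 := by
  rw [mo, monomial_eq, Finsupp.prod_fintype _ _ (by simp)]
  simp

lemma ca_mul (k : ℕ) (a : Fin d → ℕ) (g h : MvPolynomial (Fin d) (ZMod p)) :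
    ca (p ^ k) a (g ^ p ^ k * h) = g * ca (p ^ k) a h := by
  have hq : 0 < p ^ k := pow_pos (Fact.out : p.Prime).pos k
  induction g using MvPolynomial.induction_on' with
  | add g1 g2 h1 h2 => rw [add_pow_char_pow, add_mul, map_add, h1, h2, add_mul]
  | monomial u c =>
    induction h using MvPolynomial.induction_on' with
    | add g1 g2 h1 h2 => rw [mul_add, map_add, h1, h2, map_add, mul_add]
    | monomial v e =>
      rw [monomial_pow, monomial_mul, ca_monomial, ca_monomial, ZMod.pow_card_pow]
      have h1 : (fun i => (p ^ k • u + v) i % p ^ k) = fun i => v i % p ^ k := by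
        funext i
        simp [Nat.add_mod]
      rw [h1, mul_ite, mul_zero, monomial_mul]
      have h2 : dv (p ^ k) (p ^ k • u + v) = u + dv (p ^ k) v := by
        ext i
        simp [Nat.mul_add_div hq]
      rw [h2]

lemma ca_decomp (k : ℕ) (h : MvPolynomial (Fin d) (ZMod p)) :
    h = ∑ a ∈ Fintype.piFinset (fun _ : Fin d => Finset.range (p ^ k)),
      mo p a * (ca (p ^ k) a h) ^ p ^ k := by
  have hq : 0 < p ^ k := pow_pos (Fact.out : p.Prime).pos k
  induction h using MvPolynomial.induction_on' with
  | add g1 g2 h1 h2 =>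
    simp_rw [map_add, add_pow_char_pow, mul_add, Finset.sum_add_distrib, ← h1, ← h2]
  | monomial u c =>
    rw [Finset.sum_eq_single (fun i => u i % p ^ k)]
    · rw [ca_monomial, if_pos rfl, mo_eq, monomial_pow, monomial_mul, ZMod.pow_card_pow, one_mul]
      have h2 : (Finsupp.equivFunOnFinite.symm fun i => u i % p ^ k) + p ^ k • dv (p ^ k) u = u := by
        ext i
        simp [Nat.mod_add_div]
      rw [h2]
    · intro b _ hb
      rw [ca_monomial, if_neg hb, zero_pow hq.ne', mul_zero]
    · intro h
      exact absurd (Fintype.mem_piFinset.2 fun i => Finset.mem_range.2 (Nat.mod_lt _ hq)) h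

lemma ca_deg (q D : ℕ) (hq : 0 < q) (a : Fin d → ℕ) (h : MvPolynomial (Fin d) (ZMod p))
    (hh : h.totalDegree ≤ q * D) : (ca q a h).totalDegree ≤ D := by
  rw [h.as_sum, map_sum]
  refine (totalDegree_finsetSum_le ?_)
  intro u hu
  rw [ca_monomial]
  split_ifs
  · refine (totalDegree_monomial_le _ _).trans ?_
    have h1 := (le_totalDegree hu).trans hh
    refine Nat.le_of_mul_le_mul_left (le_trans ?_ h1) hq
    rw [Finsupp.sum_fintype _ _ (by simp), Finsupp.sum_fintype _ _ (by simp), Finset.mul_sum]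
    exact Finset.sum_le_sum fun i _ => by simpa using Nat.mul_div_le _ _
  · simp

lemma finite_deg (D : ℕ) : {h : MvPolynomial (Fin d) (ZMod p) | h.totalDegree ≤ D}.Finite := by
  have : Function.Injective (fun (h : {h : MvPolynomial (Fin d) (ZMod p) | h.totalDegree ≤ D})
      (u : Set.Iic (cst d D)) => coeff u.1 h.1) := by
    rintro ⟨g, hg⟩ ⟨h, hh⟩ H
    apply Subtype.ext
    apply MvPolynomial.ext
    intro u
    by_cases hu : u ≤ cst d D
    · exact congrFun H ⟨u, hu⟩
    · have : D < u.sum fun _ e => e := by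
        by_contra! hc
        refine hu fun i => le_trans ?_ hc
        rw [Finsupp.sum_fintype _ _ (by simp)]
        exact Finset.single_le_sum (f := fun i => u i) (by simp) (Finset.mem_univ i)
      rw [coeff_eq_zero_of_totalDegree_lt (lt_of_le_of_lt hg this),
        coeff_eq_zero_of_totalDegree_lt (lt_of_le_of_lt hh this)]
  have := Finite.of_injective _ this
  exact Set.toFinite _

/-- componentwise `ca` -/
noncomputable def cav {p d m : ℕ} (q : ℕ) (a : Fin d → ℕ) (w : Finset (Fin m) → MvPolynomial (Fin d) (ZMod p)) :
    Finset (Fin m) → MvPolynomial (Fin d) (ZMod p) := fun s => ca q a (w s)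

lemma kd_cav (f : Fin m → MvPolynomial (Fin d) (ZMod p)) (k : ℕ) (a : Fin d → ℕ)
    (w : Finset (Fin m) → MvPolynomial (Fin d) (ZMod p)) :
    kd f (cav (p ^ k) a w) = cav (p ^ k) a (kd (f ^ p ^ k) w) := by
  funext s
  simp only [kd, cav, map_sum]
  refine Finset.sum_congr rfl fun i _ => ?_
  have h : sg (MvPolynomial (Fin d) (ZMod p)) i s ^ p ^ k = sg (MvPolynomial (Fin d) (ZMod p)) i s := by
    rw [← iterateFrobenius_def, map_sg]
  rw [Pi.pow_apply]
  nth_rw 2 [← h]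
  rw [← mul_pow, smul_eq_mul, smul_eq_mul, ca_mul]

end decomp
end PNLC
end

section
namespace PNLC
section main
open MvPolynomial
variable {p : ℕ} [Fact p.Prime] {d m : ℕ} (f : Fin m → MvPolynomial (Fin d) (ZMod p))

lemma LL_charP (s : Finset (Fin m)) [Nontrivial (LL f s)] : CharP (LL f s) p := by
  have : Algebra (ZMod p) (LL f s) :=
      ((algebraMap (MvPolynomial (Fin d) (ZMod p)) (LL f s)).comp MvPolynomial.C).toAlgebra
  exact charP_of_injective_algebraMap (algebraMap (ZMod p) (LL f s)).injective p

lemma LL_sum_pow (s : Finset (Fin m)) (k : ℕ) {ι : Type*} (J : Finset ι) (y : ι → LL f s) :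
    (∑ i ∈ J, y i) ^ p ^ k = ∑ i ∈ J, y i ^ p ^ k := by
  rcases subsingleton_or_nontrivial (LL f s) with h | h
  · exact Subsingleton.elim _ _
  have := LL_charP f s
  exact sum_pow_char_pow p k J y

lemma LL_add_pow (s : Finset (Fin m)) (k : ℕ) (x y : LL f s) :
    (x + y) ^ p ^ k = x ^ p ^ k + y ^ p ^ k := by
  rcases subsingleton_or_nontrivial (LL f s) with h | h
  · exact Subsingleton.elim _ _
  have := LL_charP f s
  exact add_pow_char_pow x y p k

/-- the exponent box -/
def box (p d e : ℕ) : Finset (Fin d → ℕ) := Fintype.piFinset (fun _ : Fin d => Finset.range (p ^ e))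

lemma mem_box (e : ℕ) (a : Fin d → ℕ) : a ∈ box p d e ↔ ∀ i, a i < p ^ e := by
  simp [box, Fintype.mem_piFinset]

lemma io_decomp (e : ℕ) (w : Finset (Fin m) → MvPolynomial (Fin d) (ZMod p)) (s) :
    io f (p ^ e) w s = ∑ a ∈ box p d e, algebraMap _ (LL f s) (mo p a) *
      (io f 1 (cav (p ^ e) a w) s) ^ p ^ e := by
  rw [io]
  conv_lhs => rw [ca_decomp e (w s)]
  rw [fr_sum]
  refine Finset.sum_congr rfl fun a _ => ?_
  rw [fr_mul, io, fr_pow, one_mul]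
  rfl

lemma mo_pow (a : Fin d → ℕ) (n : ℕ) : mo p a ^ n = mo p (fun i => n * a i) := by
  simp [mo, ← Finset.prod_pow, ← pow_mul, mul_comm]

lemma io_decomp_pow (e k : ℕ) (w : Finset (Fin m) → MvPolynomial (Fin d) (ZMod p)) (s) :
    io f (p ^ e) w s ^ p ^ k = ∑ a ∈ box p d e, algebraMap _ (LL f s) (mo p (fun i => p ^ k * a i)) *
      (io f 1 (cav (p ^ e) a w) s) ^ p ^ (k + e) := by
  rw [io_decomp, LL_sum_pow]
  refine Finset.sum_congr rfl fun a _ => ?_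
  rw [mul_pow, ← map_pow, mo_pow, ← pow_mul, pow_add, mul_comm (p ^ e)]

/-- cocycles -/
def VV (n : ℕ) : Submodule (MvPolynomial (Fin d) (ZMod p)) (Finset (Fin m) → MvPolynomial (Fin d) (ZMod p)) where
  carrier := {v | (∀ s, s.card ≠ n → v s = 0) ∧ kd f v = 0}
  add_mem' := by
    rintro a b ⟨ha, ha'⟩ ⟨hb, hb'⟩
    refine ⟨fun s hs => by simp [ha s hs, hb s hs], by rw [kd_add, ha', hb', add_zero]⟩
  zero_mem' := ⟨by simp, by funext s; simp [kd]⟩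
  smul_mem' := by
    rintro c a ⟨ha, ha'⟩
    refine ⟨fun s hs => by simp [ha s hs], by rw [kd_smul, ha', smul_zero]⟩

/-- raising to level `p ^ e` -/
noncomputable def TT (e : ℕ) (v : Finset (Fin m) → MvPolynomial (Fin d) (ZMod p)) :
    Finset (Fin m) → MvPolynomial (Fin d) (ZMod p) := fun s => fp f s ^ (p ^ e - 1) • v s

lemma TT_def (e : ℕ) (v : Finset (Fin m) → MvPolynomial (Fin d) (ZMod p)) :
    TT f e v = fun s => fp f s ^ (p ^ e - 1) • v s := rfl

lemma pe (p : ℕ) [Fact p.Prime] (e : ℕ) : 1 + (p ^ e - 1) = p ^ e := by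
  have := pow_pos (Fact.out : p.Prime).pos e
  omega

lemma io_TT (e : ℕ) (v) : io f (p ^ e) (TT f e v) = io f 1 v := by
  rw [← io_raise f 1 (p ^ e - 1) v, pe]
  rfl

lemma cav_mem (n e : ℕ) (a) (w : Finset (Fin m) → MvPolynomial (Fin d) (ZMod p))
    (h1 : ∀ s, s.card ≠ n → w s = 0) (h2 : kd (f ^ p ^ e) w = 0) : cav (p ^ e) a w ∈ VV f n := by
  refine ⟨fun s hs => by simp [cav, h1 s hs], ?_⟩
  rw [kd_cav, h2]
  funext s
  simp [cav]

lemma cav_TT_mem (n e : ℕ) (a) (v : Finset (Fin m) → MvPolynomial (Fin d) (ZMod p)) (hv : v ∈ VV f n) :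
    cav (p ^ e) a (TT f e v) ∈ VV f n := by
  apply cav_mem
  · intro s hs
    simp [TT, hv.1 s hs]
  · funext s
    have := kd_raise f 1 (p ^ e - 1) v s
    rw [pe, pow_one, hv.2] at this
    rw [TT_def, this]
    simp

/-- closure properties -/
structure GH (G : (∀ s, LL f s) → Prop) : Prop where
  zero : G (fun _ => 0)
  add : ∀ X Y, G X → G Y → G (fun s => X s + Y s)
  mul : ∀ g X, G X → G (fun s => algebraMap (MvPolynomial (Fin d) (ZMod p)) _ g * X s)
  th : ∀ e X, G X → G (fun s => th f e s (X s))

variable {f} {G : (∀ s, LL f s) → Prop}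

lemma GH.sum (hG : GH f G) {ι : Type*} (J : Finset ι) (X : ι → ∀ s, LL f s) (h : ∀ i ∈ J, G (X i)) :
    G (fun s => ∑ i ∈ J, X i s) := by
  classical
  induction J using Finset.induction_on with
  | empty => simpa using hG.zero
  | insert i J hi ih =>
    simp only [Finset.sum_insert hi]
    exact hG.add _ _ (h i (by simp)) (ih fun j hj => h j (by simp [hj]))

/-- filtration of the cocycles -/
def VE (hG : GH f G) (n k : ℕ) : Submodule (MvPolynomial (Fin d) (ZMod p)) (Finset (Fin m) → MvPolynomial (Fin d) (ZMod p)) where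
  carrier := {v | v ∈ VV f n ∧ G (fun s => io f 1 v s ^ p ^ k)}
  add_mem' := by
    rintro a b ⟨ha, ha'⟩ ⟨hb, hb'⟩
    refine ⟨add_mem ha hb, ?_⟩
    simpa only [io, Pi.add_apply, fr_add, LL_add_pow] using hG.add _ _ ha' hb'
  zero_mem' := by
    refine ⟨zero_mem _, ?_⟩
    have : p ^ k ≠ 0 := pow_ne_zero _ (Fact.out : p.Prime).ne_zero
    simpa [io, fr, zero_pow this] using hG.zero
  smul_mem' := by
    rintro c a ⟨ha, ha'⟩
    refine ⟨Submodule.smul_mem _ _ ha, ?_⟩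
    simpa only [io, Pi.smul_apply, smul_eq_mul, fr_mul, mul_pow, ← map_pow] using
      hG.mul (c ^ p ^ k) _ ha'

lemma VE_down (hG : GH f G) (n k e : ℕ) (v) (hv : v ∈ VE hG n k) (b : Fin d → ℕ) (hb : b ∈ box p d e) :
    cav (p ^ e) b (TT f e v) ∈ VE hG n (k + e) := by
  refine ⟨cav_TT_mem f n e b v hv.1, ?_⟩
  have h1 := hG.th (p ^ (k + e) - 1) _
    (hG.mul (mo p (fun i => p ^ (k + e) - 1 - p ^ k * b i)) _ hv.2)
  convert h1 using 1
  funext s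
  have hq : 0 < p ^ k := pow_pos (Fact.out : p.Prime).pos k
  have hlt : ∀ a ∈ box p d e, ∀ i, p ^ k * a i < p ^ (k + e) := by
    intro a ha i
    rw [pow_add]
    exact Nat.mul_lt_mul_of_pos_left ((mem_box e a).1 ha i) hq
  rw [← io_TT f e v, io_decomp_pow, Finset.mul_sum, th_sum, Finset.sum_eq_single b]
  · rw [th_key f (k + e) s _ _ (hlt b hb) (hlt b hb), if_pos rfl]
  · intro a ha hab
    rw [th_key f (k + e) s _ _ (hlt a ha) (hlt b hb), if_neg]
    intro h
    apply hab
    funext i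
    exact Nat.eq_of_mul_eq_mul_left hq (congrFun h i)
  · intro h
    exact absurd hb h

lemma VE_up (hG : GH f G) (n k e : ℕ) (v) (hv : v ∈ VV f n)
    (h : ∀ a ∈ box p d e, cav (p ^ e) a (TT f e v) ∈ VE hG n (k + e)) : v ∈ VE hG n k := by
  refine ⟨hv, ?_⟩
  have : (fun s => io f 1 v s ^ p ^ k) = fun s => ∑ a ∈ box p d e,
      algebraMap _ (LL f s) (mo p (fun i => p ^ k * a i)) *
      (io f 1 (cav (p ^ e) a (TT f e v)) s) ^ p ^ (k + e) := by
    funext s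
    rw [← io_TT f e v, io_decomp_pow]
  rw [this]
  exact hG.sum (box p d e) _ fun a ha => hG.mul _ _ (h a ha).2

lemma stationary (hG : GH f G) (n : ℕ) (hV : ∀ v ∈ VV f n, G (io f 1 v)) (N : ℕ) :
    ∃ k, N ≤ k ∧ ∀ v ∈ VV f n, v ∈ VE hG n k := by
  classical
  have h0 : ∀ v ∈ VV f n, v ∈ VE hG n 0 := fun v hv => ⟨hv, by simpa using hV v hv⟩
  obtain ⟨g, hg⟩ : (VV f n).FG := IsNoetherian.noetherian _
  have hgV : ∀ v ∈ g, v ∈ VV f n := fun v hv => hg ▸ Submodule.subset_span hv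
  -- degree bound
  let D : ℕ := g.sup (fun v => Finset.univ.sup fun s => (fp f s).totalDegree + (v s).totalDegree)
  let Fs : Set (Finset (Fin m) → MvPolynomial (Fin d) (ZMod p)) :=
    {w | ∀ s, w s ∈ {h : MvPolynomial (Fin d) (ZMod p) | h.totalDegree ≤ D}}
  have hFs : Fs.Finite := by
    have := Set.Finite.pi' (fun _ : Finset (Fin m) => finite_deg (p := p) (d := d) D)
    exact this
  let AA : ℕ → Set (Finset (Fin m) → MvPolynomial (Fin d) (ZMod p)) := fun e =>
    {w | ∃ v ∈ g, ∃ a ∈ box p d e, w = cav (p ^ e) a (TT f e v)}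
  have hAA : ∀ e, AA e ∈ 𝒫 Fs := by
    rintro e w ⟨v, hv, a, ha, rfl⟩ s
    have hq := pow_pos (Fact.out : p.Prime).pos e
    refine ca_deg (p ^ e) D hq a _ ?_
    have hD : (fp f s).totalDegree + (v s).totalDegree ≤ D :=
      le_trans (Finset.le_sup (f := fun s => (fp f s).totalDegree + (v s).totalDegree)
        (Finset.mem_univ s)) (Finset.le_sup (f := fun v => Finset.univ.sup fun s =>
          (fp f s).totalDegree + (v s).totalDegree) hv)
    rw [TT, smul_eq_mul]
    refine (totalDegree_mul _ _).trans ?_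
    have h1 := totalDegree_pow (fp f s) (p ^ e - 1)
    calc _ ≤ (p ^ e - 1) * (fp f s).totalDegree + (v s).totalDegree := by gcongr
      _ ≤ p ^ e * (fp f s).totalDegree + p ^ e * (v s).totalDegree := by
        gcongr
        · omega
        · exact Nat.le_mul_of_pos_left _ hq
      _ ≤ _ := by rw [← mul_add]; gcongr
  have : Finite (𝒫 Fs) := hFs.finite_subsets
  obtain ⟨y, hy⟩ := Finite.exists_infinite_fiber (fun e : ℕ => (⟨AA e, hAA e⟩ : 𝒫 Fs))
  rw [Set.infinite_coe_iff] at hy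
  obtain ⟨e0, he0⟩ := hy.nonempty
  obtain ⟨e, he, hlt⟩ := hy.exists_gt (e0 + N)
  have hEq : AA e = AA e0 := congrArg Subtype.val (he.trans he0.symm)
  refine ⟨e - e0, by omega, ?_⟩
  have hgen : ∀ v ∈ g, v ∈ VE hG n (e - e0) := by
    intro v hv
    refine VE_up hG n (e - e0) e0 v (hgV v hv) fun a ha => ?_
    have h1 : cav (p ^ e0) a (TT f e0 v) ∈ AA e := by
      rw [hEq]; exact ⟨v, hv, a, ha, rfl⟩
    obtain ⟨v', hv', a', ha', h2⟩ := h1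
    rw [h2, Nat.sub_add_cancel (by omega)]
    have := VE_down hG n 0 e v' (h0 v' (hgV v' hv')) a' ha'
    rwa [zero_add] at this
  intro v hv
  rw [← hg] at hv
  exact Submodule.span_le.2 hgen hv

theorem G_all (hG : GH f G) (n : ℕ) (hV : ∀ v ∈ VV f n, G (io f 1 v)) (t : ℕ)
    (w : Finset (Fin m) → MvPolynomial (Fin d) (ZMod p)) (hw : ∀ s, s.card ≠ n → w s = 0)
    (hc : ∀ s, cd f (io f t w) s = 0) : G (io f t w) := by
  rw [cd_io] at hc
  obtain ⟨l, hl⟩ := io_eq_zero f t _ hc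
  obtain ⟨k, hk, hVE⟩ := stationary hG n hV (t + l)
  have hq : t + l ≤ p ^ k := hk.trans (Nat.lt_pow_self (Fact.out : p.Prime).one_lt).le
  obtain ⟨r, hr⟩ := Nat.exists_eq_add_of_le hq
  have h1 : io f t w = io f (p ^ k) (fun s => fp f s ^ (l + r) • w s) := by
    rw [hr, add_assoc, io_raise]
  have h2 : kd (f ^ p ^ k) (fun s => fp f s ^ (l + r) • w s) = 0 := by
    funext s
    rw [hr, add_assoc, kd_raise, add_comm l r, pow_add, mul_smul, hl, smul_zero]
    rfl
  rw [h1]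
  have h3 : (io f (p ^ k) (fun s => fp f s ^ (l + r) • w s)) = fun s => _ :=
    funext fun s => io_decomp f k _ s
  rw [h3]
  exact hG.sum (box p d k) _ fun a ha => hG.mul _ _
    (hVE _ (cav_mem f n k a _ (fun s hs => by simp [hw s hs]) h2)).2

end main
end PNLC
end

section
namespace PNLC
section intpart
variable {p : ℕ} [Fact p.Prime] {d m : ℕ} (F : Fin m → MvPolynomial (Fin d) ℤ)

/-- reduction mod `p` -/
noncomputable abbrev rho (p d : ℕ) : MvPolynomial (Fin d) ℤ →+* MvPolynomial (Fin d) (ZMod p) :=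
  MvPolynomial.map (Int.castRingHom (ZMod p))

lemma rho_ker (a : MvPolynomial (Fin d) ℤ) (h : rho p d a = 0) :
    ((p : ℕ) : MvPolynomial (Fin d) ℤ) ∣ a := by
  have := (MvPolynomial.C_dvd_iff_zmod p a).2 h
  simpa using this

lemma rho_p : rho p d ((p : ℕ) : MvPolynomial (Fin d) ℤ) = 0 := by
  rw [map_natCast]
  exact CharP.cast_eq_zero _ p

lemma rho_surj (b : MvPolynomial (Fin d) (ZMod p)) : ∃ a, rho p d a = b :=
  MvPolynomial.map_surjective _ (ZMod.ringHom_surjective _) b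

lemma p_nzd (a : MvPolynomial (Fin d) ℤ) (h : ((p : ℕ) : MvPolynomial (Fin d) ℤ) * a = 0) : a = 0 := by
  rcases mul_eq_zero.1 h with h | h
  · exact absurd h (by exact_mod_cast (Fact.out : p.Prime).ne_zero)
  · exact h

/-- classes that lift to cocycles -/
def GZ (p : ℕ) {d m : ℕ} (F : Fin m → MvPolynomial (Fin d) ℤ)
    (Y : ∀ s, LL (fun i => rho p d (F i)) s) : Prop :=
  ∃ X : ∀ s, LL F s, (∀ s, cd F X s = 0) ∧ ∀ s, red (rho p d) F s (X s) = Y s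

lemma GZ_GH : GH (fun i => rho p d (F i)) (GZ p F) where
  zero := ⟨fun _ => 0, fun s => by simp [cd], fun s => by simp⟩
  add := by
    rintro X Y ⟨X', h1, h2⟩ ⟨Y', h3, h4⟩
    refine ⟨X' + Y', fun s => ?_, fun s => ?_⟩
    · rw [cd_add, Pi.add_apply, h1, h3, add_zero]
    · rw [Pi.add_apply, map_add, h2, h4]
  mul := by
    rintro g X ⟨X', h1, h2⟩
    obtain ⟨g', rfl⟩ := rho_surj g
    refine ⟨fun s => algebraMap _ _ g' * X' s, fun s => ?_, fun s => ?_⟩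
    · rw [cd_mul, h1, mul_zero]
    · rw [map_mul, h2, red_algebraMap]
  th := by
    rintro e X ⟨X', h1, h2⟩
    refine ⟨fun s => th F e s (X' s), fun s => ?_, fun s => ?_⟩
    · rw [th_cd, h1, th_zero]
    · rw [red_th, h2]

/-- Koszul hypothesis for total cochains -/
def HK (p : ℕ) {d m : ℕ} (F : Fin m → MvPolynomial (Fin d) ℤ) (n : ℕ) : Prop :=
  ∀ y x : Finset (Fin m) → MvPolynomial (Fin d) ℤ, (∀ s, s.card ≠ n + 1 → y s = 0) →
    (∀ s, s.card ≠ n → x s = 0) → kd F y = 0 →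
    ((p : ℕ) : MvPolynomial (Fin d) ℤ) • y = kd F x →
    ∃ z : Finset (Fin m) → MvPolynomial (Fin d) ℤ, y = kd F z

lemma rho_kd (x : Finset (Fin m) → MvPolynomial (Fin d) ℤ) (s) :
    rho p d (kd F x s) = kd (fun i => rho p d (F i)) (fun s => rho p d (x s)) s := by
  simp [kd, map_sum, map_sg]

lemma GZ_V (n : ℕ) (hK : HK p F n) (v) (hv : v ∈ VV (fun i => rho p d (F i)) n) :
    GZ p F (io _ 1 v) := by
  choose x0 hx0 using fun s => rho_surj (v s)
  let x : Finset (Fin m) → MvPolynomial (Fin d) ℤ := fun s => if s.card = n then x0 s else 0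
  have hx : ∀ s, rho p d (x s) = v s := by
    intro s
    by_cases h : s.card = n
    · simp only [x, if_pos h, hx0]
    · simp only [x, if_neg h, map_zero, hv.1 s h]
  have hxs : ∀ s, s.card ≠ n → x s = 0 := fun s h => by simp only [x, if_neg h]
  have h1 : ∀ s, ∃ y, kd F x s = ((p : ℕ) : MvPolynomial (Fin d) ℤ) * y := by
    intro s
    apply rho_ker
    rw [rho_kd]
    simp_rw [hx]
    exact congrFun hv.2 s
  choose y hy using h1
  have hy' : ((p : ℕ) : MvPolynomial (Fin d) ℤ) • y = kd F x := by
    funext s; rw [hy]; rfl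
  have hys : ∀ s, s.card ≠ n + 1 → y s = 0 := by
    intro s hs
    apply p_nzd (p := p)
    rw [← hy]
    refine Finset.sum_eq_zero fun i hi => ?_
    rw [hxs, smul_zero]
    rw [Finset.card_erase_of_mem hi]
    have : 0 < s.card := Finset.card_pos.2 ⟨i, hi⟩
    omega
  have hyk : kd F y = 0 := by
    funext s
    apply p_nzd (p := p)
    have := congrFun (kd_kd F x) s
    rw [← hy', kd_smul] at this
    exact this
  obtain ⟨z, hz⟩ := hK y x hys hxs hyk hy'
  refine ⟨io F 1 (x - ((p : ℕ) : MvPolynomial (Fin d) ℤ) • z), fun s => ?_, fun s => ?_⟩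
  · rw [cd_io, pow_one, kd_sub, kd_smul, ← hz, hy', sub_self]
    simp [io, fr]
  · rw [red_io, io, io]
    congr 1
    rw [Pi.sub_apply, map_sub, hx, Pi.smul_apply, smul_eq_mul, map_mul, rho_p, zero_mul, sub_zero]

theorem final_kos (n : ℕ) (hK : HK p F n) (t : ℕ)
    (x w : Finset (Fin m) → MvPolynomial (Fin d) ℤ)
    (hw : ∀ s, s.card ≠ n → w s = 0)
    (hxw : ((p : ℕ) : MvPolynomial (Fin d) ℤ) • x = kd (F ^ t) w) :
    ∃ k v, ∀ s, fp F s ^ k • x s = kd (F ^ (t + k)) v s := by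
  have hcW : ∀ s, cd F (io F t w) s = algebraMap _ _ ((p : ℕ) : MvPolynomial (Fin d) ℤ) * io F t x s := by
    intro s
    rw [cd_io, ← hxw, io, io, ← fr_mul]
    rfl
  have hred : GZ p F (io _ t (fun s => rho p d (w s))) := by
    apply G_all (GZ_GH F) n (GZ_V F n hK)
    · intro s hs; rw [hw s hs, map_zero]
    · intro s
      have := red_cd (rho p d) F (io F t w) s
      simp only [red_io] at this
      rw [hcW, map_mul, red_algebraMap, rho_p, map_zero, zero_mul] at this
      exact this.symm
  obtain ⟨X, hX1, hX2⟩ := hred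
  have h1 : ∀ s, ∃ z, io F t w s - X s = algebraMap _ _ ((p : ℕ) : MvPolynomial (Fin d) ℤ) * z := by
    intro s
    apply red_ker (rho p d) F _ rho_ker
    rw [map_sub, hX2, red_io, sub_self]
  choose Z hZ using h1
  have h2 : ∀ s, cd F Z s = io F t x s := by
    intro s
    rw [← sub_eq_zero]
    apply LL_nzd F ((p : ℕ) : MvPolynomial (Fin d) ℤ) p_nzd
    rw [mul_sub, ← hcW, ← cd_mul]
    have : (fun s => algebraMap _ _ ((p : ℕ) : MvPolynomial (Fin d) ℤ) * Z s) = io F t w - X := by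
      funext s; rw [← hZ]; rfl
    rw [this, cd_sub, Pi.sub_apply, hX1, sub_zero, sub_self]
  obtain ⟨k, v, rfl⟩ := io_surj F Z t
  have h3 : ∀ s, io F (t + k) (kd (F ^ (t + k)) v - fun s => fp F s ^ k • x s) s = 0 := by
    intro s
    have := h2 s
    rw [cd_io, ← io_raise F t k x] at this
    rw [io, Pi.sub_apply, fr_sub, sub_eq_zero]
    exact this
  obtain ⟨l, hl⟩ := io_eq_zero F _ _ h3
  refine ⟨k + l, fun s => fp F s ^ l • v s, fun s => ?_⟩
  rw [← add_assoc, kd_raise]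
  have := hl s
  rw [Pi.sub_apply, smul_sub, sub_eq_zero] at this
  rw [this, smul_smul, ← pow_add, add_comm l k]

end intpart
end PNLC
end

namespace PNLC
section assemble
variable {d m : ℕ} (F : Fin m → MvPolynomial (Fin d) ℤ)

lemma koszulD_eq (n : ℕ) (x : Finset (Fin m) → MvPolynomial (Fin d) ℤ)
    (t : {s : Finset (Fin m) // s.card = n + 1}) :
    koszulD F n (fun s => x s.1) t = kd F x t.1 := by
  change (∑ i ∈ t.1.attach, _) = ∑ i ∈ t.1, _
  rw [← Finset.sum_attach t.1]
  refine Finset.sum_congr rfl fun i _ => ?_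
  rw [sg_eq, smul_eq_mul]

lemma hK_of (n p : ℕ) (hKoszul : ∀ x : koszulCohomology F (n + 1), (p : ℤ) • x = 0 → x = 0) :
    HK p F n := by
  intro y x hy hx hyk hyx
  have hker : (fun s => y s.1 : KoszulCochain (MvPolynomial (Fin d) ℤ) m (n + 1)) ∈
      LinearMap.ker (koszulD F (n + 1)) := by
    rw [LinearMap.mem_ker]
    funext t
    rw [koszulD_eq, hyk]
    rfl
  let c : LinearMap.ker (koszulD F (n + 1)) := ⟨_, hker⟩
  let N := Submodule.comap (LinearMap.ker (koszulD F (n + 1))).subtype (koszulCoboundaries F (n + 1))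
  have h1 : (Submodule.Quotient.mk (p := N) c) = 0 := by
    apply hKoszul
    have h2 : (Submodule.Quotient.mk (p := N) ((p : ℤ) • c)) = 0 := by
      rw [Submodule.Quotient.mk_eq_zero]
      change ((p : ℤ) • c).1 ∈ LinearMap.range (koszulD F n)
      refine ⟨fun s => x s.1, ?_⟩
      funext t
      rw [koszulD_eq, ← hyx]
      change ((p : ℕ) : MvPolynomial (Fin d) ℤ) * y t.1 = (p : ℤ) • y t.1
      rw [zsmul_eq_mul]
      simp
    exact h2
  rw [Submodule.Quotient.mk_eq_zero] at h1
  change c.1 ∈ LinearMap.range (koszulD F n) at h1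
  obtain ⟨z, hz⟩ := h1
  let z' : Finset (Fin m) → MvPolynomial (Fin d) ℤ := fun s => if h : s.card = n then z ⟨s, h⟩ else 0
  have hz' : (fun s => z' s.1) = z := by
    funext s
    simp only [z']
    rw [dif_pos s.2]
  refine ⟨z', ?_⟩
  funext s
  by_cases hs : s.card = n + 1
  · have := congrFun hz ⟨s, hs⟩
    rw [← hz', koszulD_eq] at this
    exact this.symm
  · rw [hy s hs]
    symm
    refine Finset.sum_eq_zero fun i hi => ?_
    have h0 : z' (s.erase i) = 0 := by
      simp only [z']
      rw [dif_neg]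
      rw [Finset.card_erase_of_mem hi]
      have : 0 < s.card := Finset.card_pos.2 ⟨i, hi⟩
      omega
    rw [h0, smul_zero]

end assemble
end PNLC

/-- If `R` is a polynomial ring over `ℤ` and a prime `p` is a nonzerodivisor on the Koszul
cohomology `H^n(f₁, …, f_m; R)`, then `p` is a nonzerodivisor on the local cohomology
`H^n_{(f₁, …, f_m)}(R)`. -/
theorem prime_nonzerodivisor_on_local_cohomology (d m n : ℕ)
    (f : Fin m → MvPolynomial (Fin d) ℤ) (p : ℕ) (hp : p.Prime)
    (hKoszul : ∀ x : koszulCohomology f n, (p : ℤ) • x = 0 → x = 0) :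
    ∀ y : (localCohomology (Ideal.span (Set.range f)) n).obj
        (ModuleCat.of (MvPolynomial (Fin d) ℤ) (MvPolynomial (Fin d) ℤ)),
      (p : ℤ) • y = 0 → y = 0 := by
  intro y hy
  haveI : Fact p.Prime := ⟨hp⟩
  have hy' : ((p : ℕ) : MvPolynomial (Fin d) ℤ) • y = 0 := by
    rw [← hy, ← Int.cast_smul_eq_zsmul (MvPolynomial (Fin d) ℤ)]
    simp
  cases n with
  | zero =>
    exact PNLC.lc_zero _ _ _ (fun a ha => PNLC.p_nzd (p := p) a ha) y hy'
  | succ n =>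
    have hK := PNLC.hK_of f n p hKoszul
    let J := Ideal.span (Set.range f)
    let P : ∀ t : ℕ, CategoryTheory.ProjectiveResolution
        (ModuleCat.of (MvPolynomial (Fin d) ℤ) (MvPolynomial (Fin d) ℤ ⧸ J ^ t)) :=
      fun t => CategoryTheory.ProjectiveResolution.of _
    refine PNLC.lc_of_inj J n _ _ P ?_ y hy'
    refine PNLC.ProCx.transfer (PNLC.kosPro f) (PNLC.resPro J P) _
      (fun k I _ _ hI => PNLC.kosPro_van hI f k) (fun k I _ _ hI => PNLC.resPro_van J P k I hI)
      n _ ?_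
    apply PNLC.kosPro_inj
    intro t x w _ hw _ hxw
    obtain ⟨k, v, h⟩ := PNLC.final_kos f n hK t x w hw hxw
    exact ⟨k, v, fun s _ => h s⟩
end

section
/- For every prime integer p, the local cohomology module H³_{Ī}(R̄) vanishes, where R̄ = (ℤ/pℤ)[u,v,w,x,y,z] and Ī is the ideal of R̄ generated by Δ1 = vz − wy, Δ2 = wx − uz, and Δ3 = uy − vx. -/
open MvPolynomial
namespace LC3
open CategoryTheory Limits

section Resolution
variable {C : Type*} [Category* C] [Abelian C]

/-- A length two complex. -/
noncomputable def cplx {P2 P1 P0 : C} (g : P2 ⟶ P1) (f : P1 ⟶ P0) (w : g ≫ f = 0) :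
    ChainComplex C ℕ :=
  ((ChainComplex.augment ((ChainComplex.single₀ C).obj P2) g zero_comp).augment f w)

lemma quasi {P2 P1 P0 Z : C} (g : P2 ⟶ P1) (f : P1 ⟶ P0) (e : P0 ⟶ Z)
    (w : g ≫ f = 0) (w' : f ≫ e = 0) [Mono g] [Epi e]
    (h1 : (ShortComplex.mk g f w).Exact) (h0 : (ShortComplex.mk f e w').Exact) :
    QuasiIso ((ChainComplex.toSingle₀Equiv (cplx g f w) Z).symm ⟨e, w'⟩) := ⟨fun n => by
    rcases n with _ | _ | _ | n
    · rw [ChainComplex.quasiIsoAt₀_iff, ShortComplex.quasiIso_iff_of_zeros']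
      · refine (ShortComplex.exact_and_epi_g_iff_of_iso ?_).2 ⟨h0, by dsimp; infer_instance⟩
        exact ShortComplex.isoMk (Iso.refl _) (Iso.refl _) (Iso.refl _)
          ((Category.id_comp f).trans (Category.comp_id f).symm)
          ((Category.id_comp e).trans ((Category.comp_id e).symm.trans
            (congrArg (fun k => k ≫ 𝟙 Z)
              (ChainComplex.toSingle₀Equiv_symm_apply_f_zero (C := cplx g f w) e w').symm)))
      all_goals rfl
    · rw [quasiIsoAt_iff_exactAt' _ _ (ChainComplex.exactAt_succ_single_obj _ _),
        HomologicalComplex.exactAt_iff' _ 2 1 0 (by simp) (by simp)]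
      exact h1
    · rw [quasiIsoAt_iff_exactAt' _ _ (ChainComplex.exactAt_succ_single_obj _ _),
        HomologicalComplex.exactAt_iff' _ 3 2 1 (by simp) (by simp)]
      rw [ShortComplex.exact_iff_mono _ (by simp [cplx]; rfl)]
      change Mono g
      infer_instance
    · rw [quasiIsoAt_iff_exactAt' _ _ (ChainComplex.exactAt_succ_single_obj _ _)]
      apply HomologicalComplex.ExactAt.of_isZero
      exact HomologicalComplex.isZero_single_obj_X (ComplexShape.down ℕ) 0 P2 (n + 1) (by simp)⟩

lemma ext_zero (R : Type*) [Ring R] [Linear R C] [EnoughProjectives C]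
    {P2 P1 P0 Z : C} (g : P2 ⟶ P1) (f : P1 ⟶ P0) (e : P0 ⟶ Z)
    [Projective P2] [Projective P1] [Projective P0]
    (w : g ≫ f = 0) (w' : f ≫ e = 0) [Mono g] [Epi e]
    (h1 : (ShortComplex.mk g f w).Exact) (h0 : (ShortComplex.mk f e w').Exact) :
    IsZero ((Ext R C 3).obj (Opposite.op Z)) := by
  rw [Functor.isZero_iff]
  intro Y
  have hz (n : ℕ) : IsZero ((cplx g f w).X (n+3)) :=
    HomologicalComplex.isZero_single_obj_X (ComplexShape.down ℕ) 0 P2 (n + 1) (by simp)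
  let P : ProjectiveResolution Z :=
    { complex := cplx g f w
      projective := fun n => by
        rcases n with _ | _ | _ | n
        · assumption
        · assumption
        · assumption
        · exact (hz n).projective
      π := (ChainComplex.toSingle₀Equiv (cplx g f w) Z).symm ⟨e, w'⟩
      quasiIso := quasi g f e w w' h1 h0 }
  refine IsZero.of_iso ?_ (P.isoExt 3 Y)
  rw [← HomologicalComplex.exactAt_iff_isZero_homology, HomologicalComplex.exactAt_iff]
  refine ShortComplex.exact_of_isZero_X₂ _ ?_
  rw [IsZero.iff_id_eq_zero]
  ext (x : _ ⟶ _)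
  obtain rfl : x = 0 := (hz 0).eq_of_src _ _
  rfl
end Resolution

section HB
variable {R : Type} [CommRing R] [IsDomain R]

lemma hb_ext (u v w x y z : R) (D1 D2 D3 : R)
    (h1 : D1 = v * z - w * y) (h2 : D2 = w * x - u * z) (h3 : D3 = u * y - v * x)
    (hD : D3 ≠ 0) (hdvd : ∀ f, D3 ∣ f * D1 → D3 ∣ f) :
    IsZero ((Ext R (ModuleCat.{0} R) 3).obj
      (Opposite.op (ModuleCat.of R (R ⧸ Ideal.span {D1, D2, D3})))) := by
  let g : (R × R) →ₗ[R] (R × R × R) :=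
    (LinearMap.toSpanSingleton R _ (u, v, w)).coprod (LinearMap.toSpanSingleton R _ (x, y, z))
  let f : (R × R × R) →ₗ[R] R :=
    (LinearMap.toSpanSingleton R _ D1).coprod
      ((LinearMap.toSpanSingleton R _ D2).coprod (LinearMap.toSpanSingleton R _ D3))
  have gapp (s t : R) : g (s, t) = (s * u + t * x, s * v + t * y, s * w + t * z) := by
    simp [g]
  have fapp (a b c : R) : f (a, b, c) = a * D1 + (b * D2 + c * D3) := by
    simp [f]
  let e : R →ₗ[R] (R ⧸ Ideal.span {D1, D2, D3}) := Submodule.mkQ _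
  have hg : Function.Injective g := by
    rw [injective_iff_map_eq_zero]
    rintro ⟨s, t⟩ h
    rw [gapp] at h
    simp only [Prod.mk_eq_zero] at h
    obtain ⟨ha, hb, -⟩ := h
    have hs : s * D3 = 0 := by rw [h3]; linear_combination y * ha - x * hb
    have ht : t * D3 = 0 := by rw [h3]; linear_combination u * hb - v * ha
    simp only [mul_eq_zero, hD, or_false] at hs ht
    simp [hs, ht]
  have w1 : ModuleCat.ofHom g ≫ ModuleCat.ofHom f = 0 := by
    ext1
    apply LinearMap.ext
    rintro ⟨s, t⟩
    change f (g (s, t)) = 0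
    rw [gapp, fapp, h1, h2, h3]
    ring
  have w0 : ModuleCat.ofHom f ≫ ModuleCat.ofHom e = 0 := by
    ext1
    apply LinearMap.ext
    rintro ⟨a, b, c⟩
    change e (f (a, b, c)) = 0
    rw [fapp]
    refine (Submodule.Quotient.mk_eq_zero _).2 ?_
    refine add_mem (Ideal.mul_mem_left _ _ (Ideal.subset_span (by simp)))
      (add_mem (Ideal.mul_mem_left _ _ (Ideal.subset_span (by simp)))
      (Ideal.mul_mem_left _ _ (Ideal.subset_span (by simp))))
  have : Mono (ModuleCat.ofHom g) := (ModuleCat.mono_iff_injective _).2 hg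
  have : Epi (ModuleCat.ofHom e) := (ModuleCat.epi_iff_surjective _).2 (Submodule.mkQ_surjective _)
  refine ext_zero R (ModuleCat.ofHom g) (ModuleCat.ofHom f) (ModuleCat.ofHom e) w1 w0 ?_ ?_
  · rw [ShortComplex.moduleCat_exact_iff]
    rintro ⟨a, b, c⟩ h
    change f (a, b, c) = 0 at h
    rw [fapp] at h
    obtain ⟨s, hs⟩ := hdvd (a * y - b * x) ⟨b * z - c * y, by
      rw [h1, h2, h3] at *; linear_combination y * h⟩
    obtain ⟨t, ht⟩ := hdvd (u * b - v * a) ⟨v * c - w * b, by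
      rw [h1, h2, h3] at *; linear_combination - v * h⟩
    refine ⟨(s, t), ?_⟩
    change g (s, t) = _
    rw [gapp]
    have e1 : D3 * (s * u + t * x) = D3 * a := by
      have : D3 * (s * u + t * x) = (D3 * s) * u + (D3 * t) * x := by ring
      rw [this, ← hs, ← ht, h3]; ring
    have e2 : D3 * (s * v + t * y) = D3 * b := by
      have : D3 * (s * v + t * y) = (D3 * s) * v + (D3 * t) * y := by ring
      rw [this, ← hs, ← ht, h3]; ring
    have e3 : D3 * (s * w + t * z) = D3 * c := by
      have : D3 * (s * w + t * z) = (D3 * s) * w + (D3 * t) * z := by ring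
      rw [this, ← hs, ← ht]
      rw [h1, h2] at h
      linear_combination -h
    rw [mul_left_cancel₀ hD e1, mul_left_cancel₀ hD e2, mul_left_cancel₀ hD e3]
  · rw [ShortComplex.moduleCat_exact_iff]
    intro r h
    change e r = 0 at h
    have h' := (Submodule.Quotient.mk_eq_zero _).1 h
    rw [Ideal.mem_span_insert] at h'
    obtain ⟨a, q, hq, rfl⟩ := h'
    rw [Ideal.mem_span_pair] at hq
    obtain ⟨b, c, rfl⟩ := hq
    exact ⟨(a, b, c), fapp a b c⟩
end HB

section Colim
open localCohomology Opposite
variable {R : Type} [CommRing R]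

lemma lc_zero (I : Ideal R) (i : ℕ)
    (h : ∀ t : ℕ, ∃ (J : Ideal R) (N : ℕ), J ≤ I ^ t ∧ I ^ N ≤ J ∧
      IsZero ((Ext R (ModuleCat.{0} R) i).obj (Opposite.op (ModuleCat.of R (R ⧸ J))))) 
    (M : ModuleCat.{0} R) :
    Subsingleton ((localCohomology I i).obj M) := by
  have : IsZero (localCohomology I i) := by
    have := hasColimitDiagram (idealPowersDiagram I) i
    change IsZero (colimit (diagram (idealPowersDiagram I) i))
    rw [IsZero.iff_id_eq_zero]
    apply colimit.hom_ext
    intro t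
    obtain ⟨t⟩ := t
    obtain ⟨t⟩ := t
    obtain ⟨J, N, hJ, hN, hz⟩ := h t
    rw [Category.comp_id, comp_zero]
    have hle : I ^ (max N t) ≤ J := (Ideal.pow_le_pow_right (le_max_left _ _)).trans hN
    let m : (op (op t) : (ℕᵒᵖ)ᵒᵖ) ⟶ op (op (max N t)) := (homOfLE (le_max_right N t)).op.op
    rw [← colimit.w _ m]
    have : (diagram (idealPowersDiagram I) i).map m = 0 := by
      let a : ModuleCat.of R (R ⧸ I ^ (max N t)) ⟶ ModuleCat.of R (R ⧸ J) :=
        ModuleCat.ofHom (Submodule.mapQ _ _ LinearMap.id hle)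
      let b : ModuleCat.of R (R ⧸ J) ⟶ ModuleCat.of R (R ⧸ I ^ t) :=
        ModuleCat.ofHom (Submodule.mapQ _ _ LinearMap.id hJ)
      have hab : (ringModIdeals (idealPowersDiagram I)).map m.unop = a ≫ b := by
        ext1
        apply LinearMap.ext
        intro r
        obtain ⟨r, rfl⟩ := Submodule.Quotient.mk_surjective _ r
        rfl
      have key : (Ext R (ModuleCat.{0} R) i).map (a ≫ b).op = 0 := by
        rw [op_comp, Functor.map_comp, hz.eq_of_tgt ((Ext R (ModuleCat.{0} R) i).map b.op) 0,
          zero_comp]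
      exact (congrArg (fun k => (Ext R (ModuleCat.{0} R) i).map (Quiver.Hom.op k)) hab).trans key
    rw [this, zero_comp]
  exact ModuleCat.subsingleton_of_isZero (this.obj M)
end Colim

lemma prime_D3 (p : ℕ) [Fact p.Prime] :
    Prime (X 0 * X 4 - X 1 * X 3 : MvPolynomial (Fin 6) (ZMod p)) := by
  have h : Irreducible (X 4 * X 0 + (- (X 1 * X 3)) : MvPolynomial (Fin 6) (ZMod p)) := by
    apply irreducible_mul_X_add
    · exact X_ne_zero _
    · simp
    · intro h
      rw [vars_neg] at h
      have := vars_mul _ _ h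
      simp at this
    · rw [IsRelPrime.neg_right_iff]
      have pr (i) : Prime (X i : MvPolynomial (Fin 6) (ZMod p)) := X_prime
      rw [(pr 4).irreducible.isRelPrime_iff_not_dvd]
      intro h
      rcases (pr 4).dvd_or_dvd h with h | h <;> simp [X_dvd_X] at h
  have := h.prime
  convert this using 1
  ring

end LC3
open LC3 in
theorem third_local_cohomology_vanishes_mod_p (p : ℕ) (hp : p.Prime)
    (u v w x y z Δ1 Δ2 Δ3 : MvPolynomial (Fin 6) (ZMod p))
    (hu : u = X 0) (hv : v = X 1) (hw : w = X 2)
    (hx : x = X 3) (hy : y = X 4) (hz : z = X 5)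
    (h1 : Δ1 = v * z - w * y) (h2 : Δ2 = w * x - u * z) (h3 : Δ3 = u * y - v * x)
    (I : Ideal (MvPolynomial (Fin 6) (ZMod p))) (hI : I = Ideal.span {Δ1, Δ2, Δ3}) :
    Subsingleton ((localCohomology I 3).obj
      (ModuleCat.of (MvPolynomial (Fin 6) (ZMod p)) (MvPolynomial (Fin 6) (ZMod p)))) := by
  have : Fact p.Prime := ⟨hp⟩
  have hP : Prime Δ3 := by rw [h3, hu, hv, hx, hy]; exact prime_D3 p
  have hnd : ¬ Δ3 ∣ Δ1 := by
    intro h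
    have := map_dvd (eval (fun i : Fin 6 => if i = 1 ∨ i = 5 then (1 : ZMod p) else 0)) h
    rw [h1, h3, hu, hv, hw, hx, hy, hz] at this
    simp at this
  have m1 : Δ1 ∈ I := by rw [hI]; exact Ideal.subset_span (by simp)
  have m2 : Δ2 ∈ I := by rw [hI]; exact Ideal.subset_span (by simp)
  have m3 : Δ3 ∈ I := by rw [hI]; exact Ideal.subset_span (by simp)
  apply lc_zero
  intro t
  have hq : t ≤ p ^ t := (Nat.lt_pow_self hp.one_lt).le
  let J := Ideal.span {Δ1 ^ p ^ t, Δ2 ^ p ^ t, Δ3 ^ p ^ t}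
  have hrad : I ≤ J.radical := by
    rw [hI, Ideal.span_le]
    rintro a (rfl | rfl | rfl) <;>
      exact ⟨p ^ t, Ideal.subset_span (by simp)⟩
  obtain ⟨N, hN⟩ := Ideal.exists_pow_le_of_le_radical_of_fg hrad (IsNoetherian.noetherian _)
  refine ⟨J, N, ?_, hN, ?_⟩
  · rw [Ideal.span_le]
    rintro a (rfl | rfl | rfl) <;>
      exact Ideal.pow_le_pow_right hq (Ideal.pow_mem_pow (by assumption) _)
  · refine hb_ext (u ^ p ^ t) (v ^ p ^ t) (w ^ p ^ t) (x ^ p ^ t) (y ^ p ^ t) (z ^ p ^ t) _ _ _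
      ?_ ?_ ?_ (pow_ne_zero _ hP.ne_zero) ?_
    · rw [h1, sub_pow_char_pow, mul_pow, mul_pow]
    · rw [h2, sub_pow_char_pow, mul_pow, mul_pow]
    · rw [h3, sub_pow_char_pow, mul_pow, mul_pow]
    · intro f hf
      exact hP.pow_dvd_of_dvd_mul_right _ (fun h => hnd (hP.dvd_of_dvd_pow h)) hf
end
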